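/- arXiv:2006.08118 — 5 statements merged into one kernel-verified Lean document; each statement's English description precedes it below -/
import Mathlib

section
/- Let U be a hollow and uniform right R-module, put M = U², U₁ = U × 0 and U₂ = 0 × U. If M is lifting, then for any right R-module X, any homomorphism f : U₁ → X and any surjective homomorphism g : U₂ → X, one of the following holds: (i) there exists a homomorphism h : U₁ → U₂ such that f = g ∘ h; (ii) there exist a submodule N of U₂ and a surjective homomorphism h : N → U₁ such that g restricted to N equals f ∘ h. -/
/-- A submodule `N` of `M` is *small* (superfluous) in `M` if `N + X ≠ M`
for every proper submodule `X` of `M`. -/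
def IsSmallSubmodule {R M : Type*} [Ring R] [AddCommGroup M] [Module R M]
    (N : Submodule R M) : Prop :=
  ∀ X : Submodule R M, X ≠ ⊤ → N ⊔ X ≠ ⊤

/-- A nonzero module `M` is *hollow* if every proper submodule of `M` is small in `M`. -/
def IsHollowModule (R M : Type*) [Ring R] [AddCommGroup M] [Module R M] : Prop :=
  Nontrivial M ∧ ∀ N : Submodule R M, N ≠ ⊤ → IsSmallSubmodule N

/-- A submodule `N` of `M` is *essential* in `M` if `N ∩ X ≠ 0`
for every nonzero submodule `X` of `M`. -/
def IsEssentialSubmodule {R M : Type*} [Ring R] [AddCommGroup M] [Module R M]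
    (N : Submodule R M) : Prop :=
  ∀ X : Submodule R M, X ≠ ⊥ → N ⊓ X ≠ ⊥

/-- A nonzero module `M` is *uniform* if every nonzero submodule of `M` is essential in `M`. -/
def IsUniformModule (R M : Type*) [Ring R] [AddCommGroup M] [Module R M] : Prop :=
  Nontrivial M ∧ ∀ N : Submodule R M, N ≠ ⊥ → IsEssentialSubmodule N

/-- `X` is a direct summand of `M`. -/
def IsDirectSummand {R M : Type*} [Ring R] [AddCommGroup M] [Module R M]
    (X : Submodule R M) : Prop :=
  ∃ Y : Submodule R M, IsCompl X Y

/-- A module `M` is *lifting* if for every submodule `N` of `M` there is a direct summand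
`X` of `M` with `X ⊆ N` such that `N/X` is small in `M/X`. -/
def IsLiftingModule (R M : Type*) [Ring R] [AddCommGroup M] [Module R M] : Prop :=
  ∀ N : Submodule R M, ∃ X : Submodule R M,
    X ≤ N ∧ IsDirectSummand X ∧ IsSmallSubmodule (N.map X.mkQ)

/-- A module `M` is *extending* if for every submodule `N` of `M` there is a direct summand
`X` of `M` such that `N` is essential in `X`. -/
def IsExtendingModule (R M : Type*) [Ring R] [AddCommGroup M] [Module R M] : Prop :=
  ∀ N : Submodule R M, ∃ X : Submodule R M,
    IsDirectSummand X ∧ N ≤ X ∧ ∀ Y : Submodule R M, Y ≤ X → Y ≠ ⊥ → N ⊓ Y ≠ ⊥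

/-- A module is *uniserial* if its submodules are linearly ordered by inclusion. -/
def IsUniserialModule (R M : Type*) [Ring R] [AddCommGroup M] [Module R M] : Prop :=
  ∀ A B : Submodule R M, A ≤ B ∨ B ≤ A

/-- An internal finite direct sum decomposition `M = ⨁ᵢ Fᵢ`. -/
def IsInternalDirectSum {R M ι : Type*} [Ring R] [AddCommGroup M] [Module R M]
    (F : ι → Submodule R M) : Prop :=
  (⨆ i, F i) = ⊤ ∧ ∀ i, Disjoint (F i) (⨆ j ∈ ({i}ᶜ : Set ι), F j)

/-- A module `M` satisfies the *finite internal exchange property* if for any direct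
summand `X` of `M` and any finite direct sum decomposition `M = M₁ ⊕ ⋯ ⊕ Mₙ` there are
submodules `Mᵢ' ⊆ Mᵢ` with `M = X ⊕ M₁' ⊕ ⋯ ⊕ Mₙ'`. -/
def SatisfiesFIEP (R M : Type*) [Ring R] [AddCommGroup M] [Module R M] : Prop :=
  ∀ (X : Submodule R M), IsDirectSummand X →
    ∀ (n : ℕ) (Mi : Fin n → Submodule R M), IsInternalDirectSum Mi →
      ∃ Mi' : Fin n → Submodule R M, (∀ i, Mi' i ≤ Mi i) ∧
        IsInternalDirectSum (fun o : Option (Fin n) => o.elim X Mi')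

theorem aux_inter {R U M : Type*} [Ring R] [AddCommGroup U] [Module R U]
    [AddCommGroup M] [Module R M] (hU : IsUniformModule R U) (φ : M →ₗ[R] U)
    (A : Submodule R U) (hA : A ≠ ⊥) (Y : Submodule R M) (hY : Y ≠ ⊥) :
    Y ⊓ A.comap φ ≠ ⊥ := by
  by_cases h : Y.map φ = ⊥
  · have : Y ≤ A.comap φ := by
      intro y hy
      have : φ y ∈ Y.map φ := ⟨y, hy, rfl⟩
      rw [h, Submodule.mem_bot] at this
      simp [this]
    rwa [inf_eq_left.2 this]
  · obtain ⟨z, hz, hz0⟩ := Submodule.exists_mem_ne_zero_of_ne_bot (hU.2 A hA _ h)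
    obtain ⟨hzA, y, hy, rfl⟩ := hz
    refine (Submodule.ne_bot_iff _).2 ⟨y, ⟨hy, hzA⟩, ?_⟩
    rintro rfl
    simp at hz0

/-- Let `U` be hollow and uniform, `M = U²`, `U₁ = U × 0`, `U₂ = 0 × U`. If `M` is lifting,
then for any module `X`, any homomorphism `f : U₁ → X` and any surjective homomorphism
`g : U₂ → X`, either (i) there is `h : U₁ → U₂` with `f = g ∘ h`, or (ii) there are a
submodule `N` of `U₂` and a surjective homomorphism `h : N → U₁` with `g|_N = f ∘ h`. -/
theorem stmt_3 {R U : Type*} [Ring R] [AddCommGroup U] [Module R U]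
    (hH : IsHollowModule R U) (hU : IsUniformModule R U)
    (hlift : IsLiftingModule R (U × U)) :
    ∀ (X : Type*) [AddCommGroup X] [Module R X]
      (f : ↥(Submodule.fst R U U) →ₗ[R] X) (g : ↥(Submodule.snd R U U) →ₗ[R] X),
      Function.Surjective g →
        (∃ h : ↥(Submodule.fst R U U) →ₗ[R] ↥(Submodule.snd R U U), f = g ∘ₗ h) ∨
        (∃ (N : Submodule R ↥(Submodule.snd R U U))
            (h : ↥N →ₗ[R] ↥(Submodule.fst R U U)),
          Function.Surjective h ∧ g ∘ₗ N.subtype = f ∘ₗ h) := by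
  intro X _ _ f g hg
  let e₁ := Submodule.fstEquiv R U U
  let e₂ := Submodule.sndEquiv R U U
  let f' : U →ₗ[R] X := f ∘ₗ e₁.symm.toLinearMap
  let g' : U →ₗ[R] X := g ∘ₗ e₂.symm.toLinearMap
  let N : Submodule R (U × U) :=
    LinearMap.ker (f' ∘ₗ LinearMap.fst R U U - g' ∘ₗ LinearMap.snd R U U)
  have hN : ∀ p : U × U, p ∈ N ↔ f' p.1 = g' p.2 := by
    intro p
    simp [N, sub_eq_zero]
  obtain ⟨S, hSN, ⟨Y, hY⟩, hsm⟩ := hlift N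
  have hS2 : S ⊔ LinearMap.ker (LinearMap.fst R U U) = ⊤ := by
    by_contra hne
    refine hsm ((S ⊔ LinearMap.ker (LinearMap.fst R U U)).map S.mkQ) ?_ ?_
    · intro h
      apply hne
      have := congrArg (Submodule.comap S.mkQ) h
      rw [Submodule.comap_map_mkQ, Submodule.comap_top] at this
      simpa using this
    · rw [← Submodule.map_sup]
      have : N ⊔ (S ⊔ LinearMap.ker (LinearMap.fst R U U)) = ⊤ := by
        rw [eq_top_iff]
        rintro ⟨a, b⟩ -
        obtain ⟨c, hc⟩ := hg (f' a)
        refine Submodule.mem_sup.2 ⟨(a, e₂ c), ?_, (0, b - e₂ c), ?_, ?_⟩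
        · rw [hN]; simp [g', hc]
        · exact Submodule.mem_sup_right (by simp)
        · simp
      rw [this, Submodule.map_top, Submodule.range_mkQ]
  have hsurj : ∀ a : U, ∃ s ∈ S, s.1 = a := by
    intro a
    have : ((a, 0) : U × U) ∈ S ⊔ LinearMap.ker (LinearMap.fst R U U) := by simp [hS2]
    obtain ⟨s, hs, t, ht, hst⟩ := Submodule.mem_sup.1 this
    refine ⟨s, hs, ?_⟩
    have h1 := congrArg Prod.fst hst
    have h2 : t.1 = 0 := by simpa using ht
    simpa [h2] using h1
  by_cases hB : S.comap (LinearMap.inr R U U) = ⊥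
  · left
    let p : S →ₗ[R] U := LinearMap.fst R U U ∘ₗ S.subtype
    have hp : Function.Bijective p := by
      constructor
      · rw [← LinearMap.ker_eq_bot, LinearMap.ker_eq_bot']
        rintro ⟨⟨a, b⟩, hs⟩ h
        have ha : a = 0 := h
        subst ha
        have : b ∈ S.comap (LinearMap.inr R U U) := hs
        rw [hB, Submodule.mem_bot] at this
        subst this
        rfl
      · intro a
        obtain ⟨s, hs, h⟩ := hsurj a
        exact ⟨⟨s, hs⟩, h⟩
    let e := LinearEquiv.ofBijective p hp
    refine ⟨e₂.symm.toLinearMap ∘ₗ LinearMap.snd R U U ∘ₗ S.subtype ∘ₗ e.symm.toLinearMap ∘ₗ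
      e₁.toLinearMap, ?_⟩
    ext x
    have h1 := (hN _).1 (hSN (e.symm (e₁ x)).2)
    have h2 : (e.symm (e₁ x)).1.1 = e₁ x := e.apply_symm_apply (e₁ x)
    rw [h2] at h1
    have h3 : f' (e₁ x) = f x := by simp [f']
    rw [h3] at h1
    exact h1
  by_cases hA : S.comap (LinearMap.inl R U U) = ⊥
  · right
    let k : S →ₗ[R] Submodule.snd R U U :=
      e₂.symm.toLinearMap ∘ₗ LinearMap.snd R U U ∘ₗ S.subtype
    have hk : Function.Injective k := by
      rw [← LinearMap.ker_eq_bot, LinearMap.ker_eq_bot']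
      rintro ⟨⟨a, b⟩, hs⟩ h
      have hb : b = 0 := by
        have : e₂.symm b = 0 := h
        simpa using this
      subst hb
      have : a ∈ S.comap (LinearMap.inl R U U) := hs
      rw [hA, Submodule.mem_bot] at this
      subst this
      rfl
    let e := LinearEquiv.ofInjective k hk
    refine ⟨LinearMap.range k, e₁.symm.toLinearMap ∘ₗ LinearMap.fst R U U ∘ₗ S.subtype ∘ₗ
      e.symm.toLinearMap, ?_, ?_⟩
    · intro x
      obtain ⟨s, hs, h⟩ := hsurj (e₁ x)
      refine ⟨e ⟨s, hs⟩, ?_⟩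
      simp [h]
    · apply LinearMap.ext
      intro y
      obtain ⟨s, rfl⟩ := e.surjective y
      have h1 := (hN _).1 (hSN s.2)
      simp only [LinearMap.comp_apply, LinearEquiv.coe_coe, LinearEquiv.symm_apply_apply]
      exact h1.symm
  · left
    have hY0 : Y = ⊥ := by
      by_contra h0
      have h1 := aux_inter hU (LinearMap.fst R U U) _ hA Y h0
      have h2 := aux_inter hU (LinearMap.snd R U U) _ hB _ h1
      obtain ⟨⟨a, b⟩, ⟨⟨hy, ha⟩, hb⟩, hne⟩ := Submodule.exists_mem_ne_zero_of_ne_bot h2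
      have ha' : ((a, 0) : U × U) ∈ S := ha
      have hb' : ((0, b) : U × U) ∈ S := hb
      have hs : ((a, b) : U × U) ∈ S := by simpa using S.add_mem ha' hb'
      exact hne (Submodule.disjoint_def.1 hY.disjoint _ hs hy)
    have hS : S = ⊤ := by
      have := hY.sup_eq_top
      rwa [hY0, sup_bot_eq] at this
    refine ⟨0, ?_⟩
    apply LinearMap.ext
    intro x
    have h1 := (hN (e₁ x, 0)).1 (hSN (by simp [hS]))
    simpa [f'] using h1
end

section
/- Let U be a uniform and hollow right R-module and put M = U², U₁ = U × 0 and U₂ = 0 × U. Then M is extending if and only if for any right R-module X, any homomorphism f : X → U₂ and any injective homomorphism g : X → U₁, either (i) there exists a homomorphism h : U₁ → U₂ with f = h ∘ g, or (ii) there exist a submodule K of U₁ and an injective homomorphism h : U₂ → U₁/K such that h ∘ f = π ∘ g, where π : U₁ → U₁/K is the natural epimorphism. -/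
universe u

theorem unif_elem {R : Type*} {U : Type u} [Ring R] [AddCommGroup U] [Module R U]
    (hU : IsUniformModule R U) (Q : Submodule R U) (hQ : Q ≠ ⊥) (a : U) (ha : a ≠ 0) :
    ∃ r : R, r • a ∈ Q ∧ r • a ≠ 0 := by
  have h := hU.2 Q hQ (Submodule.span R {a}) (by simpa using ha)
  obtain ⟨x, hx, hx0⟩ := (Submodule.ne_bot_iff _).1 h
  obtain ⟨r, rfl⟩ := Submodule.mem_span_singleton.1 hx.2
  exact ⟨r, hx.1, hx0⟩

/-- a nonzero submodule contained in a split copy of `U` is essential in a summand -/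
theorem summand_of_split {R : Type*} {U : Type u} [Ring R] [AddCommGroup U] [Module R U]
    (hU : IsUniformModule R U) (N : Submodule R (U × U)) (hN : N ≠ ⊥)
    (i : U →ₗ[R] U × U) (p : U × U →ₗ[R] U) (hp : ∀ u, p (i u) = u)
    (hi : ∀ x ∈ N, ∃ u, i u = x) :
    ∃ X : Submodule R (U × U),
    IsDirectSummand X ∧ N ≤ X ∧ ∀ Y : Submodule R (U × U), Y ≤ X → Y ≠ ⊥ → N ⊓ Y ≠ ⊥ := by
  refine ⟨LinearMap.range i, ⟨LinearMap.ker p, ?_⟩, fun x hx => hi x hx, ?_⟩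
  · constructor
    · rw [Submodule.disjoint_def]
      rintro _ ⟨u, rfl⟩ h
      have : u = 0 := by rw [← hp u]; exact h
      simp [this]
    · rw [codisjoint_iff, eq_top_iff]
      intro x _
      refine Submodule.mem_sup.2 ⟨i (p x), ⟨_, rfl⟩, x - i (p x), ?_, by abel⟩
      simp [hp]
  · intro Y hY hY0
    obtain ⟨y, hy, hy0⟩ := (Submodule.ne_bot_iff _).1 hY0
    obtain ⟨n, hn, hn0⟩ := (Submodule.ne_bot_iff _).1 hN
    obtain ⟨u, rfl⟩ := hY hy
    obtain ⟨v, rfl⟩ := hi n hn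
    have hu : u ≠ 0 := by rintro rfl; simp at hy0
    have hv : v ≠ 0 := by rintro rfl; simp at hn0
    obtain ⟨r, h1, h2⟩ := unif_elem hU (N.comap i)
      ((Submodule.ne_bot_iff _).2 ⟨v, hn, hv⟩) u hu
    refine (Submodule.ne_bot_iff _).2 ⟨i (r • u), ⟨h1, ?_⟩, ?_⟩
    · rw [map_smul]; exact Y.smul_mem r hy
    · intro h; apply h2; rw [← hp (r • u), h, map_zero]

theorem essential_of_both {R : Type*} {U : Type u} [Ring R] [AddCommGroup U] [Module R U]
    (hU : IsUniformModule R U) (N : Submodule R (U × U))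
    (h1 : ∃ a : U, a ≠ 0 ∧ (a, (0 : U)) ∈ N) (h2 : ∃ a : U, a ≠ 0 ∧ ((0 : U), a) ∈ N)
    (Y : Submodule R (U × U)) (hY : Y ≠ ⊥) : N ⊓ Y ≠ ⊥ := by
  obtain ⟨a, ha, haN⟩ := h1
  obtain ⟨b, hb, hbN⟩ := h2
  have hP : N.comap (LinearMap.inl R U U) ≠ ⊥ := (Submodule.ne_bot_iff _).2 ⟨a, haN, ha⟩
  have hQ : N.comap (LinearMap.inr R U U) ≠ ⊥ := (Submodule.ne_bot_iff _).2 ⟨b, hbN, hb⟩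
  obtain ⟨⟨c, d⟩, hy, hy0⟩ := (Submodule.ne_bot_iff _).1 hY
  rw [Submodule.ne_bot_iff]
  by_cases hc : c = 0
  · subst hc
    have hd : d ≠ 0 := by rintro rfl; exact hy0 rfl
    obtain ⟨r, hr, hr0⟩ := unif_elem hU _ hQ d hd
    have hr : ((0 : U), r • d) ∈ N := hr
    have := Y.smul_mem r hy
    refine ⟨(0, r • d), ⟨hr, by simpa using this⟩, ?_⟩
    intro h; exact hr0 (Prod.ext_iff.1 h).2
  · obtain ⟨r, hr, hr0⟩ := unif_elem hU _ hP c hc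
    have hr : (r • c, (0 : U)) ∈ N := hr
    have hry : (r • c, r • d) ∈ Y := Y.smul_mem r hy
    by_cases hd : r • d = 0
    · refine ⟨(r • c, 0), ⟨hr, by simpa [hd] using hry⟩, ?_⟩
      intro h; exact hr0 (Prod.ext_iff.1 h).1
    · obtain ⟨s, hs, hs0⟩ := unif_elem hU _ hQ _ hd
      have hs : ((0 : U), s • r • d) ∈ N := hs
      have hsy : (s • r • c, s • r • d) ∈ Y := Y.smul_mem s hry
      refine ⟨(s • r • c, s • r • d), ⟨?_, hsy⟩, ?_⟩
      · have h3 := N.smul_mem s hr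
        have := N.add_mem h3 hs
        simpa using this
      · intro h; exact hs0 (Prod.ext_iff.1 h).2

/-- In a hollow module's square a submodule with both projections proper is not co-complemented. -/
theorem hollow_cases {R : Type*} {U : Type u} [Ring R] [AddCommGroup U] [Module R U]
    (hH : IsHollowModule R U) (A B : Submodule R (U × U)) (hAB : A ⊔ B = ⊤) (hB : B ≠ ⊤) :
    A.map (LinearMap.fst R U U) = ⊤ ∨ A.map (LinearMap.snd R U U) = ⊤ := by
  by_contra! hcon
  obtain ⟨hP, hQ⟩ := hcon
  set P := A.map (LinearMap.fst R U U) with hPdef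
  set Q := A.map (LinearMap.snd R U U) with hQdef
  set Y := Q.map (LinearMap.inr R U U) ⊔ B with hYdef
  have hall : ∀ z : U × U, ∃ p ∈ P, ∃ q ∈ Q, ∃ b ∈ B, z = (p, q) + b := by
    intro z
    have hz : z ∈ A ⊔ B := hAB ▸ Submodule.mem_top
    obtain ⟨a, ha, b, hb, rfl⟩ := Submodule.mem_sup.1 hz
    exact ⟨a.1, ⟨a, ha, rfl⟩, a.2, ⟨a, ha, rfl⟩, b, hb, rfl⟩
  have hY1 : Y.comap (LinearMap.inl R U U) = ⊤ := by
    by_contra hne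
    apply hH.2 P hP _ hne
    rw [eq_top_iff]
    intro u _
    obtain ⟨p, hp, q, hq, b, hb, h⟩ := hall (u, 0)
    refine Submodule.mem_sup.2 ⟨p, hp, u - p, ?_, by abel⟩
    refine Submodule.mem_sup.2 ⟨(0, q), ⟨q, hq, rfl⟩, b, hb, ?_⟩
    have h' := Prod.ext_iff.1 h
    simp only [Prod.fst_add, Prod.snd_add] at h'
    ext
    · simp [h'.1]
    · simp [← h'.2]
  have hY : ∀ z : U × U, ∃ q ∈ Q, ∃ b ∈ B, z = (0, q) + b := by
    intro z
    have hz : z ∈ Y := by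
      obtain ⟨p, hp, q, hq, b, hb, rfl⟩ := hall z
      have h1 : (p, (0 : U)) ∈ Y := by
        have : p ∈ Y.comap (LinearMap.inl R U U) := hY1 ▸ Submodule.mem_top
        exact this
      have h2 : ((0 : U), q) ∈ Y := Submodule.mem_sup_left ⟨q, hq, rfl⟩
      have h3 := Y.add_mem (Y.add_mem h1 h2) (Submodule.mem_sup_right hb)
      simpa using h3
    obtain ⟨_, ⟨q, hq, rfl⟩, b, hb, rfl⟩ := Submodule.mem_sup.1 hz
    exact ⟨q, hq, b, hb, rfl⟩
  have hB1 : B.comap (LinearMap.inr R U U) = ⊤ := by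
    by_contra hne
    apply hH.2 Q hQ _ hne
    rw [eq_top_iff]
    intro u _
    obtain ⟨q, hq, b, hb, h⟩ := hY (0, u)
    refine Submodule.mem_sup.2 ⟨q, hq, u - q, ?_, by abel⟩
    have : LinearMap.inr R U U (u - q) = b := by
      have h' := Prod.ext_iff.1 h
      simp only [Prod.fst_add, Prod.snd_add] at h'
      ext
      · simpa using h'.1
      · simp [h'.2]
    change LinearMap.inr R U U (u - q) ∈ B
    rwa [this]
  apply hB
  rw [eq_top_iff]
  intro z _
  obtain ⟨q, hq, b, hb, rfl⟩ := hY z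
  have : q ∈ B.comap (LinearMap.inr R U U) := hB1 ▸ Submodule.mem_top
  exact B.add_mem this hb

def ExtCond (R : Type*) (U : Type u) [Ring R] [AddCommGroup U] [Module R U] : Prop :=
  ∀ (X : Type u) [AddCommGroup X] [Module R X]
      (f : X →ₗ[R] ↥(Submodule.snd R U U)) (g : X →ₗ[R] ↥(Submodule.fst R U U)),
      Function.Injective g →
        (∃ h : ↥(Submodule.fst R U U) →ₗ[R] ↥(Submodule.snd R U U), f = h ∘ₗ g) ∨
        (∃ (K : Submodule R ↥(Submodule.fst R U U))
            (h : ↥(Submodule.snd R U U) →ₗ[R] (↥(Submodule.fst R U U) ⧸ K)),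
          Function.Injective h ∧ h ∘ₗ f = K.mkQ ∘ₗ g)

theorem cond_inj {R : Type*} {U : Type u} [Ring R] [AddCommGroup U] [Module R U]
    (hU : IsUniformModule R U) (hC : ExtCond R U) (X : Type u) [AddCommGroup X] [Module R X]
    [Nontrivial X] (f g : X →ₗ[R] U) (hf : Function.Injective f) (hg : Function.Injective g) :
    (∃ h : U →ₗ[R] U, ∀ x, f x = h (g x)) ∨ (∃ h : U →ₗ[R] U, ∀ x, h (f x) = g x) := by
  let e1 := Submodule.fstEquiv R U U
  let e2 := Submodule.sndEquiv R U U
  rcases hC X (e2.symm.toLinearMap ∘ₗ f) (e1.symm.toLinearMap ∘ₗ g)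
    (e1.symm.injective.comp hg) with ⟨h, hh⟩ | ⟨K, h, hinj, hh⟩
  · left
    refine ⟨e2.toLinearMap ∘ₗ h ∘ₗ e1.symm.toLinearMap, fun x => ?_⟩
    have := LinearMap.congr_fun hh x
    simp only [LinearMap.comp_apply, LinearEquiv.coe_coe] at this ⊢
    rw [← this, LinearEquiv.apply_symm_apply]
  · right
    have hh' : ∀ x, h (e2.symm (f x)) = K.mkQ (e1.symm (g x)) := fun x => LinearMap.congr_fun hh x
    have hK : K = ⊥ := by
      by_contra hK
      obtain ⟨k, hk, hk0⟩ := (Submodule.ne_bot_iff _).1 hK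
      obtain ⟨x, hx⟩ := exists_ne (0 : X)
      have hgx : g x ≠ 0 := fun h0 => hx (hg (by simpa using h0))
      obtain ⟨r, hr, hr0⟩ := unif_elem hU (K.comap e1.symm.toLinearMap)
        ((Submodule.ne_bot_iff _).2 ⟨e1 k, by simpa using hk, by simpa using hk0⟩) (g x) hgx
      have hr : e1.symm (r • g x) ∈ K := hr
      apply hr0
      have h1 := hh' (r • x)
      rw [map_smul g, (Submodule.Quotient.mk_eq_zero K).2 hr |> (fun h => (h : K.mkQ _ = 0))] at h1
      have h2 : e2.symm (f (r • x)) = 0 := hinj (by simpa using h1)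
      have h3 : f (r • x) = 0 := e2.symm.map_eq_zero_iff.1 h2
      have h4 : r • x = 0 := hf (by simpa using h3)
      rw [← map_smul, h4, map_zero]
    let q := Submodule.quotEquivOfEqBot K hK
    refine ⟨e1.toLinearMap ∘ₗ q.toLinearMap ∘ₗ h ∘ₗ e2.symm.toLinearMap, fun x => ?_⟩
    simp only [LinearMap.comp_apply, LinearEquiv.coe_coe]
    rw [hh']
    have : q (K.mkQ (e1.symm (g x))) = e1.symm (g x) := by
      simp [q]
    rw [this, LinearEquiv.apply_symm_apply]

theorem core {R : Type*} {U : Type u} [Ring R] [AddCommGroup U] [Module R U]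
    (hU : IsUniformModule R U) (hC : ExtCond R U) (X : Type u) [AddCommGroup X] [Module R X]
    [Nontrivial X] (f g : X →ₗ[R] U) (hg : Function.Injective g) :
    ∃ (i : U →ₗ[R] U × U) (p : U × U →ₗ[R] U), (∀ u, p (i u) = u) ∧
      ∀ x, ∃ u, i u = (g x, f x) := by
  by_cases hf : Function.Injective f
  · rcases cond_inj hU hC X f g hf hg with ⟨h, hh⟩ | ⟨h, hh⟩
    · exact ⟨LinearMap.id.prod h, LinearMap.fst R U U, fun u => rfl,
        fun x => ⟨g x, by simp [hh]⟩⟩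
    · exact ⟨h.prod LinearMap.id, LinearMap.snd R U U, fun u => rfl,
        fun x => ⟨f x, by simp [hh]⟩⟩
  · have hfg : Function.Injective (f + g) := by
      rw [injective_iff_map_eq_zero] at hf ⊢
      push Not at hf
      obtain ⟨k, hk, hk0⟩ := hf
      intro x hx
      by_contra hx0
      have hgx : g x ≠ 0 := fun h0 => hx0 (hg (by simpa using h0))
      have hgk : g k ≠ 0 := fun h0 => hk0 (hg (by simpa using h0))
      obtain ⟨r, hr, hr0⟩ := unif_elem hU ((LinearMap.ker f).map g)
        ((Submodule.ne_bot_iff _).2 ⟨g k, ⟨k, hk, rfl⟩, hgk⟩) (g x) hgx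
      obtain ⟨y, hy, hyx⟩ := hr
      have h1 : y = r • x := hg (by rw [hyx, map_smul])
      have h2 : f (r • x) = 0 := by rw [← h1]; exact hy
      have h3 : (f + g) (r • x) = 0 := by rw [map_smul, hx, smul_zero]
      rw [LinearMap.add_apply, h2, zero_add, map_smul] at h3
      exact hr0 h3
    rcases cond_inj hU hC X (f + g) g hfg hg with ⟨h, hh⟩ | ⟨h, hh⟩
    · refine ⟨LinearMap.id.prod (h - LinearMap.id), LinearMap.fst R U U, fun u => rfl,
        fun x => ⟨g x, ?_⟩⟩
      simp [← hh]
    · refine ⟨h.prod (LinearMap.id - h), LinearMap.fst R U U + LinearMap.snd R U U,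
        fun u => by simp, fun x => ⟨(f + g) x, ?_⟩⟩
      have := hh x
      ext
      · simpa using this
      · change (f + g) x - h ((f + g) x) = f x
        rw [this]; simp

theorem extending_of_cond {R : Type*} {U : Type u} [Ring R] [AddCommGroup U] [Module R U]
    (hU : IsUniformModule R U) (hC : ExtCond R U) : IsExtendingModule R (U × U) := by
  intro N
  by_cases hN : N = ⊥
  · subst hN
    exact ⟨⊥, ⟨⊤, isCompl_bot_top⟩, le_rfl, fun Y hY hY0 => absurd (le_bot_iff.1 hY) hY0⟩
  haveI : Nontrivial N := Submodule.nontrivial_iff_ne_bot.2 hN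
  by_cases h1 : Function.Injective (LinearMap.fst R U U ∘ₗ N.subtype)
  · obtain ⟨i, p, hp, hi⟩ := core hU hC N (LinearMap.snd R U U ∘ₗ N.subtype) _ h1
    exact summand_of_split hU N hN i p hp (fun x hx => hi ⟨x, hx⟩)
  by_cases h2 : Function.Injective (LinearMap.snd R U U ∘ₗ N.subtype)
  · obtain ⟨i, p, hp, hi⟩ := core hU hC N (LinearMap.fst R U U ∘ₗ N.subtype) _ h2
    let s : U × U →ₗ[R] U × U := (LinearMap.snd R U U).prod (LinearMap.fst R U U)
    have hs : ∀ z, s (s z) = z := fun z => rfl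
    refine summand_of_split hU N hN (s ∘ₗ i) (p ∘ₗ s) (fun u => ?_) (fun x hx => ?_)
    · simp only [LinearMap.comp_apply, hs, hp]
    · obtain ⟨u, hu⟩ := hi ⟨x, hx⟩
      exact ⟨u, by rw [LinearMap.comp_apply, hu]; rfl⟩
  refine ⟨⊤, ⟨⊥, isCompl_top_bot⟩, le_top, fun Y _ hY => essential_of_both hU N ?_ ?_ Y hY⟩
  · rw [injective_iff_map_eq_zero] at h2
    push Not at h2
    obtain ⟨⟨⟨a, b⟩, hx⟩, h0, hne⟩ := h2
    have h0 : b = 0 := h0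
    subst h0
    exact ⟨a, fun ha => hne (by subst ha; rfl), hx⟩
  · rw [injective_iff_map_eq_zero] at h1
    push Not at h1
    obtain ⟨⟨⟨a, b⟩, hx⟩, h0, hne⟩ := h1
    have h0 : a = 0 := h0
    subst h0
    exact ⟨b, fun ha => hne (by subst ha; rfl), hx⟩

/-- a single-valued, everywhere defined relation is the graph of a linear map -/
theorem exists_map_of_rel {R V W : Type*} [Ring R] [AddCommGroup V] [Module R V]
    [AddCommGroup W] [Module R W] (A : Submodule R (V × W))
    (h1 : ∀ v, ∃ w, (v, w) ∈ A) (h2 : ∀ w, ((0 : V), w) ∈ A → w = 0) :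
    ∃ h : V →ₗ[R] W, ∀ v, (v, h v) ∈ A := by
  choose h hh using h1
  have key : ∀ v w, (v, w) ∈ A → h v = w := by
    intro v w hw
    have := A.sub_mem (hh v) hw
    have := h2 (h v - w) (by simpa using this)
    exact sub_eq_zero.1 this
  exact ⟨{ toFun := h
           map_add' := fun x y => key _ _ (A.add_mem (hh x) (hh y))
           map_smul' := fun r x => key _ _ (A.smul_mem r (hh x)) }, hh⟩

theorem cond_of_extending {R : Type*} {U : Type u} [Ring R] [AddCommGroup U] [Module R U]
    (hH : IsHollowModule R U) (hE : IsExtendingModule R (U × U)) : ExtCond R U := by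
  intro X _ _ f g hg
  let e1 := Submodule.fstEquiv R U U
  let e2 := Submodule.sndEquiv R U U
  let n : X →ₗ[R] U × U := (e1.toLinearMap ∘ₗ g).prod (e2.toLinearMap ∘ₗ f)
  obtain ⟨A, ⟨B, hAB⟩, hNA, hess⟩ := hE (LinearMap.range n)
  by_cases hX : ∀ x : X, x = 0
  · left
    refine ⟨0, LinearMap.ext fun x => ?_⟩
    rw [hX x]; simp
  push Not at hX
  obtain ⟨x0, hx0⟩ := hX
  have hnA : ∀ x, (e1 (g x), e2 (f x)) ∈ A := fun x => hNA ⟨x, rfl⟩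
  have hA0 : ∀ w, ((0 : U), w) ∈ A → w = 0 := by
    intro w hw
    by_contra hw0
    have := hess (A ⊓ LinearMap.ker (LinearMap.fst R U U)) inf_le_left
      ((Submodule.ne_bot_iff _).2 ⟨(0, w), ⟨hw, rfl⟩, fun h => hw0 (Prod.ext_iff.1 h).2⟩)
    obtain ⟨z, ⟨⟨x, rfl⟩, _, hz⟩, hz0⟩ := (Submodule.ne_bot_iff _).1 this
    have hz : e1 (g x) = 0 := hz
    have h1 : g x = 0 := by simpa using hz
    have h2 : x = 0 := hg (by simpa using h1)
    exact hz0 (by rw [h2, map_zero])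
  have hB : B ≠ ⊤ := by
    rintro rfl
    have hA : A = ⊥ := by simpa using hAB.disjoint
    have := hnA x0
    rw [hA] at this
    have h0 : e1 (g x0) = 0 := (Prod.ext_iff.1 ((Submodule.mem_bot R).1 this)).1
    have h1 : g x0 = 0 := by simpa using h0
    exact hx0 (hg (by simpa using h1))
  rcases hollow_cases hH A B hAB.sup_eq_top hB with h | h
  · left
    obtain ⟨k, hk⟩ := exists_map_of_rel A (fun v => by
      have : v ∈ A.map (LinearMap.fst R U U) := h ▸ Submodule.mem_top
      obtain ⟨⟨a, b⟩, hab, rfl⟩ := this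
      exact ⟨b, hab⟩) hA0
    refine ⟨e2.symm.toLinearMap ∘ₗ k ∘ₗ e1.toLinearMap, LinearMap.ext fun x => ?_⟩
    simp only [LinearMap.comp_apply, LinearEquiv.coe_coe]
    rw [LinearEquiv.eq_symm_apply]
    have := A.sub_mem (hnA x) (hk (e1 (g x)))
    exact sub_eq_zero.1 (hA0 _ (by simpa using this))
  · right
    let j : ↥(Submodule.fst R U U) →ₗ[R] U × U := LinearMap.inl R U U ∘ₗ e1.toLinearMap
    let K := A.comap j
    have hKm : ∀ y, y ∈ K ↔ (e1 y, (0 : U)) ∈ A := fun y => Iff.rfl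
    -- the image relation
    let T : ↥(Submodule.fst R U U) × ↥(Submodule.snd R U U) →ₗ[R] U × U :=
      LinearMap.prodMap e1.toLinearMap e2.toLinearMap
    let S : ↥(Submodule.fst R U U) × ↥(Submodule.snd R U U) →ₗ[R]
        ↥(Submodule.snd R U U) × (↥(Submodule.fst R U U) ⧸ K) :=
      (LinearMap.snd R _ _).prod (K.mkQ ∘ₗ LinearMap.fst R _ _)
    let C := (A.comap T).map S
    have hC : ∀ a b, (e1 a, e2 b) ∈ A → (b, K.mkQ a) ∈ C := fun a b hab => ⟨(a, b), hab, rfl⟩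
    have hC' : ∀ b q, (b, q) ∈ C → ∃ a, (e1 a, e2 b) ∈ A ∧ K.mkQ a = q := by
      rintro b q ⟨⟨a, b'⟩, hab, h⟩
      have h3 : b' = b := (Prod.ext_iff.1 h).1
      subst h3
      exact ⟨a, hab, (Prod.ext_iff.1 h).2⟩
    have hC0 : ∀ q, (0, q) ∈ C → q = 0 := by
      intro q hq
      obtain ⟨a, ha, rfl⟩ := hC' _ _ hq
      rw [map_zero] at ha
      exact (Submodule.Quotient.mk_eq_zero K).2 ((hKm a).2 ha)
    obtain ⟨k, hk⟩ := exists_map_of_rel C (fun v => by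
      have : e2 v ∈ A.map (LinearMap.snd R U U) := h ▸ Submodule.mem_top
      obtain ⟨⟨a, b⟩, hab, hb⟩ := this
      have hb : b = e2 v := hb
      subst hb
      exact ⟨K.mkQ (e1.symm a), hC _ _ (by simpa using hab)⟩) hC0
    refine ⟨K, k, ?_, LinearMap.ext fun x => ?_⟩
    · rw [injective_iff_map_eq_zero]
      intro b hb
      obtain ⟨a, ha, ha2⟩ := hC' _ _ (hk b)
      rw [hb] at ha2
      have haK := (hKm a).1 ((Submodule.Quotient.mk_eq_zero K).1 ha2)
      have := hA0 (e2 b) (by simpa using A.sub_mem ha haK)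
      simpa using this
    · have h1 := hC _ _ (hnA x)
      have := C.sub_mem (hk (f x)) h1
      exact sub_eq_zero.1 (hC0 _ (by simpa using this))

/-- Let `U` be uniform and hollow, `M = U²`, `U₁ = U × 0`, `U₂ = 0 × U`. Then `M` is
extending if and only if for every module `X`, every homomorphism `f : X → U₂` and every
injective homomorphism `g : X → U₁`, either (i) there is `h : U₁ → U₂` with `f = h ∘ g`,
or (ii) there are a submodule `K` of `U₁` and an injective homomorphism `h : U₂ → U₁/K`
such that `h ∘ f = π ∘ g`, where `π : U₁ → U₁/K` is the natural epimorphism. -/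
theorem stmt_10 {R : Type*} {U : Type u} [Ring R] [AddCommGroup U] [Module R U]
    (hU : IsUniformModule R U) (hH : IsHollowModule R U) :
    IsExtendingModule R (U × U) ↔
    (∀ (X : Type u) [AddCommGroup X] [Module R X]
      (f : X →ₗ[R] ↥(Submodule.snd R U U)) (g : X →ₗ[R] ↥(Submodule.fst R U U)),
      Function.Injective g →
        (∃ h : ↥(Submodule.fst R U U) →ₗ[R] ↥(Submodule.snd R U U), f = h ∘ₗ g) ∨
        (∃ (K : Submodule R ↥(Submodule.fst R U U))
            (h : ↥(Submodule.snd R U U) →ₗ[R] (↥(Submodule.fst R U U) ⧸ K)),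
          Function.Injective h ∧ h ∘ₗ f = K.mkQ ∘ₗ g)) := by
  exact ⟨fun h => cond_of_extending hH h, fun h => extending_of_cond hU h⟩
end

section
/- Let p and q be two distinct prime numbers, let ℤ_(p) and ℤ_(q) be the localizations of ℤ at p and q respectively, let R be the ring of matrices [[a, x],[0, b]] with a ∈ ℤ_(p), x ∈ ℚ, b ∈ ℤ_(q), let L be the right ideal of R consisting of matrices [[0, x],[0, y]] with x, y ∈ ℤ_(q), and let U = R/L as a right R-module. Then the right R-module U² does not satisfy the finite internal exchange property. -/
/-- The localization `ℤ_(p)` of `ℤ` at the prime `p`, realized as the subring of `ℚ`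
consisting of the fractions `n / d` with `p ∤ d`. -/
def Zloc (p : ℕ) (hp : p.Prime) : Subring ℚ where
  carrier := {x : ℚ | ∃ n d : ℤ, ¬ (p : ℤ) ∣ d ∧ x * d = n}
  zero_mem' := ⟨0, 1, by simpa using (Nat.prime_iff_prime_int.mp hp).not_dvd_one, by norm_num⟩
  one_mem' := ⟨1, 1, by simpa using (Nat.prime_iff_prime_int.mp hp).not_dvd_one, by norm_num⟩
  add_mem' := by
    rintro x y ⟨n1, d1, hd1, h1⟩ ⟨n2, d2, hd2, h2⟩
    refine ⟨n1 * d2 + n2 * d1, d1 * d2, ?_, ?_⟩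
    · intro h
      rcases ((Nat.prime_iff_prime_int.mp hp).dvd_mul.mp h) with h | h
      exacts [hd1 h, hd2 h]
    · push_cast
      calc (x + y) * ((d1 : ℚ) * d2) = (x * d1) * d2 + (y * d2) * d1 := by ring
        _ = (n1 : ℚ) * d2 + (n2 : ℚ) * d1 := by rw [h1, h2]
  neg_mem' := by
    rintro x ⟨n, d, hd, h⟩
    exact ⟨-n, d, hd, by push_cast; linarith⟩
  mul_mem' := by
    rintro x y ⟨n1, d1, hd1, h1⟩ ⟨n2, d2, hd2, h2⟩
    refine ⟨n1 * n2, d1 * d2, ?_, ?_⟩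
    · intro h
      rcases ((Nat.prime_iff_prime_int.mp hp).dvd_mul.mp h) with h | h
      exacts [hd1 h, hd2 h]
    · push_cast
      calc (x * y) * ((d1 : ℚ) * d2) = (x * d1) * (y * d2) := by ring
        _ = (n1 : ℚ) * n2 := by rw [h1, h2]

/-- The triangular matrix ring `[[ℤ_(p), ℚ], [0, ℤ_(q)]]`, as a subring of the `2 × 2`
rational matrices. -/
def TriRing (p q : ℕ) (hp : p.Prime) (hq : q.Prime) :
    Subring (Matrix (Fin 2) (Fin 2) ℚ) where
  carrier := {A | A 1 0 = 0 ∧ A 0 0 ∈ Zloc p hp ∧ A 1 1 ∈ Zloc q hq}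
  zero_mem' := ⟨rfl, (Zloc p hp).zero_mem, (Zloc q hq).zero_mem⟩
  one_mem' := ⟨by simp [Matrix.one_apply], by simpa using (Zloc p hp).one_mem,
    by simpa using (Zloc q hq).one_mem⟩
  add_mem' := by
    rintro A B ⟨hA0, hA1, hA2⟩ ⟨hB0, hB1, hB2⟩
    exact ⟨by simp [hA0, hB0], (Zloc p hp).add_mem hA1 hB1, (Zloc q hq).add_mem hA2 hB2⟩
  neg_mem' := by
    rintro A ⟨hA0, hA1, hA2⟩
    exact ⟨by simp [hA0], (Zloc p hp).neg_mem hA1, (Zloc q hq).neg_mem hA2⟩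
  mul_mem' := by
    rintro A B ⟨hA0, hA1, hA2⟩ ⟨hB0, hB1, hB2⟩
    refine ⟨?_, ?_, ?_⟩
    · simp [Matrix.mul_apply, Fin.sum_univ_two, hA0, hB0]
    · have : (A * B) 0 0 = A 0 0 * B 0 0 + A 0 1 * B 1 0 := by
        simp [Matrix.mul_apply, Fin.sum_univ_two]
      rw [this, hB0, mul_zero, add_zero]
      exact (Zloc p hp).mul_mem hA1 hB1
    · have : (A * B) 1 1 = A 1 0 * B 0 1 + A 1 1 * B 1 1 := by
        simp [Matrix.mul_apply, Fin.sum_univ_two]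
      rw [this, hA0, zero_mul, zero_add]
      exact (Zloc q hq).mul_mem hA2 hB2

/-- The right ideal `L = [[0, ℤ_(q)], [0, ℤ_(q)]]` of `TriRing p q`, as a submodule of the
right module `TriRing p q` over itself. -/
def Lideal (p q : ℕ) (hp : p.Prime) (hq : q.Prime) :
    Submodule (TriRing p q hp hq)ᵐᵒᵖ (TriRing p q hp hq) where
  carrier := {A | (A : Matrix (Fin 2) (Fin 2) ℚ) 0 0 = 0 ∧
    (A : Matrix (Fin 2) (Fin 2) ℚ) 0 1 ∈ Zloc q hq ∧
    (A : Matrix (Fin 2) (Fin 2) ℚ) 1 1 ∈ Zloc q hq}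
  zero_mem' := ⟨rfl, (Zloc q hq).zero_mem, (Zloc q hq).zero_mem⟩
  add_mem' := by
    rintro A B ⟨hA0, hA1, hA2⟩ ⟨hB0, hB1, hB2⟩
    exact ⟨by simp [hA0, hB0], by simpa using (Zloc q hq).add_mem hA1 hB1,
      by simpa using (Zloc q hq).add_mem hA2 hB2⟩
  smul_mem' := by
    rintro r A ⟨hA0, hA1, hA2⟩
    have hr := r.unop.2
    have hsmul : ((r • A : TriRing p q hp hq) : Matrix (Fin 2) (Fin 2) ℚ) =
        (A : Matrix (Fin 2) (Fin 2) ℚ) * (r.unop : Matrix (Fin 2) (Fin 2) ℚ) := rfl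
    refine ⟨?_, ?_, ?_⟩
    · rw [hsmul]
      have : ((A : Matrix (Fin 2) (Fin 2) ℚ) * (r.unop : Matrix (Fin 2) (Fin 2) ℚ)) 0 0 =
          (A : Matrix (Fin 2) (Fin 2) ℚ) 0 0 * (r.unop : Matrix (Fin 2) (Fin 2) ℚ) 0 0 +
          (A : Matrix (Fin 2) (Fin 2) ℚ) 0 1 * (r.unop : Matrix (Fin 2) (Fin 2) ℚ) 1 0 := by
        simp [Matrix.mul_apply, Fin.sum_univ_two]
      rw [this, hA0, hr.1, zero_mul, mul_zero, add_zero]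
    · rw [hsmul]
      have : ((A : Matrix (Fin 2) (Fin 2) ℚ) * (r.unop : Matrix (Fin 2) (Fin 2) ℚ)) 0 1 =
          (A : Matrix (Fin 2) (Fin 2) ℚ) 0 0 * (r.unop : Matrix (Fin 2) (Fin 2) ℚ) 0 1 +
          (A : Matrix (Fin 2) (Fin 2) ℚ) 0 1 * (r.unop : Matrix (Fin 2) (Fin 2) ℚ) 1 1 := by
        simp [Matrix.mul_apply, Fin.sum_univ_two]
      rw [this, hA0, zero_mul, zero_add]
      exact (Zloc q hq).mul_mem hA1 hr.2.2
    · rw [hsmul]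
      have : ((A : Matrix (Fin 2) (Fin 2) ℚ) * (r.unop : Matrix (Fin 2) (Fin 2) ℚ)) 1 1 =
          (A : Matrix (Fin 2) (Fin 2) ℚ) 1 0 * (r.unop : Matrix (Fin 2) (Fin 2) ℚ) 0 1 +
          (A : Matrix (Fin 2) (Fin 2) ℚ) 1 1 * (r.unop : Matrix (Fin 2) (Fin 2) ℚ) 1 1 := by
        simp [Matrix.mul_apply, Fin.sum_univ_two]
      rw [this, A.2.1, zero_mul, zero_add]
      exact (Zloc q hq).mul_mem hA2 hr.2.2

/-- The uniserial module `U = R/L`. -/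
abbrev Umod (p q : ℕ) (hp : p.Prime) (hq : q.Prime) :=
  TriRing p q hp hq ⧸ Lideal p q hp hq

theorem aux_one_sub_ne (p : ℕ) (hp : p.Prime) (a : ℚ) (ha : a ∈ Zloc p hp) : 1 - p * a ≠ 0 := by
  obtain ⟨n, d, hd, h⟩ := ha
  intro h0
  apply hd
  refine ⟨n, ?_⟩
  have : (d : ℚ) = p * n := by
    rw [← h]
    linear_combination (d : ℚ) * h0
  exact_mod_cast this

theorem aux_div_not_mem (p q : ℕ) (hp : p.Prime) (hq : q.Prime) (hpq : p ≠ q) :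
    (p / q : ℚ) ∉ Zloc q hq := by
  rintro ⟨n, d, hd, h⟩
  have hq0 : (q : ℚ) ≠ 0 := by exact_mod_cast hq.ne_zero
  have h1 : (p : ℚ) * d = q * n := by
    rw [← h]; field_simp
  have h2 : (p : ℤ) * d = q * n := by exact_mod_cast h1
  have h3 : (q : ℤ) ∣ p * d := ⟨n, h2⟩
  rcases (Nat.prime_iff_prime_int.mp hq).dvd_mul.mp h3 with h | h
  · have : q ∣ p := by exact_mod_cast h
    exact hpq ((Nat.prime_dvd_prime_iff_eq hq hp).mp this).symm
  · exact hd h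

/-- The strictly upper triangular element of the ring with given corner. -/
def auxE (p q : ℕ) (hp : p.Prime) (hq : q.Prime) (y : ℚ) : TriRing p q hp hq :=
  ⟨!![0, y; 0, 0], by
    refine ⟨by simp, ?_, ?_⟩
    · simpa using (Zloc p hp).zero_mem
    · simpa using (Zloc q hq).zero_mem⟩

theorem aux_zsmul (p q : ℕ) (hp : p.Prime) (hq : q.Prime) (k : ℤ) (A : TriRing p q hp hq)
    (i j : Fin 2) : ((k • A : TriRing p q hp hq) : Matrix (Fin 2) (Fin 2) ℚ) i j =
      k * (A : Matrix (Fin 2) (Fin 2) ℚ) i j := by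
  have h : ((k • A : TriRing p q hp hq) : Matrix (Fin 2) (Fin 2) ℚ) =
      k • (A : Matrix (Fin 2) (Fin 2) ℚ) := rfl
  rw [h, Matrix.smul_apply, zsmul_eq_mul]

/-- The map `u ↦ (a u, b u)`. -/
def auxMap (R U : Type*) [Ring R] [AddCommGroup U] [Module R U] (a b : ℤ) : U →ₗ[R] U × U :=
  (a • LinearMap.id).prod (b • LinearMap.id)

theorem auxMap_apply (R U : Type*) [Ring R] [AddCommGroup U] [Module R U] (a b : ℤ) (u : U) :
    auxMap R U a b u = (a • u, b • u) := rfl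

theorem aux_summand (R U : Type*) [Ring R] [AddCommGroup U] [Module R U] (a b s t : ℤ)
    (h : a * t - b * s = 1) : IsDirectSummand (LinearMap.range (auxMap R U a b)) := by
  refine ⟨LinearMap.range (auxMap R U s t), ?_, ?_⟩
  · rw [Submodule.disjoint_def]
    rintro _ ⟨u, rfl⟩ ⟨v, hv⟩
    simp only [auxMap_apply, Prod.mk.injEq] at hv
    have hu : u = 0 := by
      calc u = (a * t - b * s) • u := by rw [h, one_smul]
        _ = t • (a • u) - s • (b • u) := by module
        _ = t • (s • v) - s • (t • v) := by rw [hv.1, hv.2]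
        _ = 0 := by module
    rw [hu, map_zero]
  · rw [codisjoint_iff, eq_top_iff]
    rintro ⟨x, y⟩ -
    refine Submodule.mem_sup.mpr ⟨_, ⟨t • x - s • y, rfl⟩, _, ⟨-b • x + a • y, rfl⟩, ?_⟩
    simp only [auxMap_apply, Prod.mk_add_mk, Prod.mk.injEq]
    constructor
    · calc _ = (a * t - b * s) • x := by module
        _ = x := by rw [h, one_smul]
    · calc _ = (a * t - b * s) • y := by module
        _ = y := by rw [h, one_smul]

theorem aux_decomp (R U : Type*) [Ring R] [AddCommGroup U] [Module R U] :
    IsInternalDirectSum (![LinearMap.range (LinearMap.inl R U U),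
      LinearMap.range (LinearMap.inr R U U)]) := by
  have hc : IsCompl (LinearMap.range (LinearMap.inl R U U))
      (LinearMap.range (LinearMap.inr R U U)) := LinearMap.isCompl_range_inl_inr
  refine ⟨?_, ?_⟩
  · rw [eq_top_iff, ← hc.sup_eq_top]
    exact sup_le (le_iSup_of_le 0 le_rfl) (le_iSup_of_le 1 le_rfl)
  · intro i
    fin_cases i
    · refine hc.disjoint.mono_right (iSup₂_le fun j hj => ?_)
      fin_cases j
      · exact absurd rfl hj
      · exact le_rfl
    · refine hc.disjoint.symm.mono_right (iSup₂_le fun j hj => ?_)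
      fin_cases j
      · exact le_rfl
      · exact absurd rfl hj

/-- For distinct primes `p`, `q`, the right `R`-module `U²` does not satisfy the finite
internal exchange property, where `U = R/L`, `R = [[ℤ_(p), ℚ], [0, ℤ_(q)]]` and
`L = [[0, ℤ_(q)], [0, ℤ_(q)]]`. -/
theorem stmt_15 (p q : ℕ) (hp : p.Prime) (hq : q.Prime) (hpq : p ≠ q) :
    ¬ SatisfiesFIEP (TriRing p q hp hq)ᵐᵒᵖ (Umod p q hp hq × Umod p q hp hq) := by
  intro H
  have hcop : IsCoprime (p : ℤ) (q : ℤ) :=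
    Nat.isCoprime_iff_coprime.mpr ((Nat.coprime_primes hp hq).mpr hpq)
  obtain ⟨t, s, hts⟩ := hcop
  obtain ⟨N, hN, htop, hdis⟩ := H _
    (aux_summand _ (Umod p q hp hq) (p : ℤ) (q : ℤ) (-s) t (by linear_combination hts)) 2 _
    (aux_decomp _ (Umod p q hp hq))
  set X := LinearMap.range
    (auxMap (TriRing p q hp hq)ᵐᵒᵖ (Umod p q hp hq) (p : ℤ) (q : ℤ)) with hX
  have hle : (⨆ o : Option (Fin 2), o.elim X N) ≤ X ⊔ (N 0 ⊔ N 1) := by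
    refine iSup_le fun o => ?_
    rcases o with _ | i
    · exact le_sup_left
    · refine le_trans ?_ le_sup_right
      fin_cases i
      · exact le_sup_left
      · exact le_sup_right
  have hd : Disjoint X (N 0) :=
    (hdis none).mono_right (le_iSup₂_of_le (some 0) (by simp) le_rfl)
  have hmem : ((Submodule.Quotient.mk 1, 0) : Umod p q hp hq × Umod p q hp hq) ∈
      X ⊔ (N 0 ⊔ N 1) := hle (by rw [htop]; trivial)
  obtain ⟨_, ⟨u, rfl⟩, w, hw, hsum⟩ := Submodule.mem_sup.mp hmem
  obtain ⟨m, hm, m', hm', rfl⟩ := Submodule.mem_sup.mp hw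
  obtain ⟨v, rfl⟩ := hN 0 hm
  obtain ⟨v', rfl⟩ := hN 1 hm'
  obtain ⟨A, rfl⟩ := Submodule.Quotient.mk_surjective _ u
  obtain ⟨B, rfl⟩ := Submodule.Quotient.mk_surjective _ v
  have h1 := congrArg Prod.fst hsum
  simp only [auxMap_apply, LinearMap.inl_apply, LinearMap.inr_apply, Prod.fst_add,
    add_zero] at h1
  have h2 : (Submodule.Quotient.mk ((p : ℤ) • A + B) : Umod p q hp hq) =
      Submodule.Quotient.mk 1 := h1
  rw [Submodule.Quotient.eq] at h2
  have h3 := h2.1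
  have hB : (B : Matrix (Fin 2) (Fin 2) ℚ) 0 0 =
      1 - p * (A : Matrix (Fin 2) (Fin 2) ℚ) 0 0 := by
    have h4 : (((p : ℤ) • A : TriRing p q hp hq) : Matrix (Fin 2) (Fin 2) ℚ) 0 0 +
        (B : Matrix (Fin 2) (Fin 2) ℚ) 0 0 - 1 = 0 := h3
    rw [aux_zsmul, Int.cast_natCast] at h4
    linear_combination h4
  have hB0 : (B : Matrix (Fin 2) (Fin 2) ℚ) 0 0 ≠ 0 := by
    rw [hB]; exact aux_one_sub_ne p hp _ A.2.2.1
  have hq0 : (q : ℚ) ≠ 0 := by exact_mod_cast hq.ne_zero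
  have hBr : B * auxE p q hp hq (p / q / (B : Matrix (Fin 2) (Fin 2) ℚ) 0 0) =
      auxE p q hp hq (p / q) := by
    have hB10 := B.2.1
    apply Subtype.ext
    ext i j
    fin_cases i <;> fin_cases j <;>
      simp [auxE, Matrix.mul_apply, Fin.sum_univ_two, hB10]
    field_simp
  have hz : ((Submodule.Quotient.mk (auxE p q hp hq (p / q)), 0) :
      Umod p q hp hq × Umod p q hp hq) ∈ N 0 := by
    have := (N 0).smul_mem
      (MulOpposite.op (auxE p q hp hq (p / q / (B : Matrix (Fin 2) (Fin 2) ℚ) 0 0))) hm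
    rw [← hBr]
    convert this using 1
    simp only [LinearMap.inl_apply, Prod.smul_mk, smul_zero]
    rfl
  have hzX : ((Submodule.Quotient.mk (auxE p q hp hq (p / q)), 0) :
      Umod p q hp hq × Umod p q hp hq) ∈ X := by
    refine ⟨Submodule.Quotient.mk (auxE p q hp hq (1 / q)), ?_⟩
    rw [auxMap_apply]
    have e1 : (p : ℤ) • auxE p q hp hq (1 / q) = auxE p q hp hq (p / q) := by
      apply Subtype.ext
      ext i j
      rw [aux_zsmul]
      fin_cases i <;> fin_cases j <;> simp [auxE]
      field_simp
    have e2 : (q : ℤ) • auxE p q hp hq (1 / q) ∈ Lideal p q hp hq := by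
      have e3 : (q : ℤ) • auxE p q hp hq (1 / q) = auxE p q hp hq 1 := by
        apply Subtype.ext
        ext i j
        rw [aux_zsmul]
        fin_cases i <;> fin_cases j <;> simp [auxE, hq0]
      rw [e3]
      refine ⟨by simp [auxE], ?_, (auxE p q hp hq 1).2.2.2⟩
      simpa [auxE] using (Zloc q hq).one_mem
    refine Prod.ext ?_ ?_
    · exact congrArg Submodule.Quotient.mk e1
    · exact (Submodule.Quotient.mk_eq_zero _).mpr e2
  have hz0 := congrArg Prod.fst (Submodule.disjoint_def.mp hd _ hzX hz)
  have hzL := (Submodule.Quotient.mk_eq_zero (Lideal p q hp hq)).mp hz0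
  have := hzL.2.1
  exact aux_div_not_mem p q hp hq hpq (by simpa [auxE] using this)
end

section
/- There exist a ring R and a right R-module M such that M is lifting but M does not satisfy the finite internal exchange property. (Specifically, one may take R to be the ring of matrices [[a, x],[0, b]] with a ∈ ℤ_(p), x ∈ ℚ, b ∈ ℤ_(q) for distinct primes p, q, and M = (R/L)² where L is the right ideal of matrices [[0, x],[0, y]] with x, y ∈ ℤ_(q).) -/
namespace Ex23

abbrev R23 := TriRing 2 3 Nat.prime_two Nat.prime_three
abbrev U23 := Umod 2 3 Nat.prime_two Nat.prime_three

/-- The matrix `[[s, t], [0, 0]]` as an element of the ring. -/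
def rowElt (s t : ℚ) (hs : s ∈ Zloc 2 Nat.prime_two) : R23 :=
  ⟨!![s, t; 0, 0], by
    refine ⟨by simp, by simpa using hs, ?_⟩
    simpa using (Zloc 3 Nat.prime_three).zero_mem⟩

theorem zsmul_entry (n : ℤ) (A : R23) (i j : Fin 2) :
    ((n • A : R23) : Matrix (Fin 2) (Fin 2) ℚ) i j = n * (A : Matrix (Fin 2) (Fin 2) ℚ) i j := by
  have : ((n • A : R23) : Matrix (Fin 2) (Fin 2) ℚ) = n • (A : Matrix (Fin 2) (Fin 2) ℚ) :=
    map_zsmul (TriRing 2 3 Nat.prime_two Nat.prime_three).subtype n A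
  rw [this, Matrix.smul_apply, zsmul_eq_mul]

/-- The preimage in the ring of the radical of `U`. -/
def Jideal : Submodule R23ᵐᵒᵖ R23 where
  carrier := {A | ∃ z ∈ Zloc 2 Nat.prime_two, (A : Matrix (Fin 2) (Fin 2) ℚ) 0 0 = 2 * z}
  zero_mem' := ⟨0, (Zloc 2 Nat.prime_two).zero_mem, by simp⟩
  add_mem' := by
    rintro A B ⟨z, hz, h⟩ ⟨w, hw, h'⟩
    refine ⟨z + w, (Zloc 2 Nat.prime_two).add_mem hz hw, ?_⟩
    simp [h, h', mul_add]
  smul_mem' := by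
    rintro r A ⟨z, hz, h⟩
    have hr := r.unop.2
    have hsmul : ((r • A : R23) : Matrix (Fin 2) (Fin 2) ℚ) =
        (A : Matrix (Fin 2) (Fin 2) ℚ) * (r.unop : Matrix (Fin 2) (Fin 2) ℚ) := rfl
    refine ⟨z * (r.unop : Matrix (Fin 2) (Fin 2) ℚ) 0 0,
      (Zloc 2 Nat.prime_two).mul_mem hz hr.2.1, ?_⟩
    rw [hsmul, Matrix.mul_apply, Fin.sum_univ_two, hr.1, h]
    ring

/-- The radical of `U`. -/
def Jrad : Submodule R23ᵐᵒᵖ U23 := Jideal.map (Lideal 2 3 Nat.prime_two Nat.prime_three).mkQ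

theorem mk_mem_Jrad (A : R23) :
    (Submodule.Quotient.mk A : U23) ∈ Jrad ↔ A ∈ Jideal := by
  constructor
  · rintro ⟨B, hB, h⟩
    have h1 := (Submodule.Quotient.eq _).1 h
    obtain ⟨z, hz, hB⟩ := hB
    refine ⟨z, hz, ?_⟩
    have h2 := h1.1
    simp only [AddSubgroupClass.coe_sub, Matrix.sub_apply] at h2
    linarith
  · intro h
    exact ⟨A, h, rfl⟩

theorem one_not_mem : (Submodule.Quotient.mk 1 : U23) ∉ Jrad := by
  rw [mk_mem_Jrad]
  rintro ⟨z, ⟨n, d, hd, hz⟩, h⟩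
  simp at h
  have h1 : z = 1 / 2 := by linarith
  subst h1
  apply hd
  refine ⟨n, ?_⟩
  have : (d : ℚ) = 2 * n := by linarith
  exact_mod_cast this

theorem two_smul_mem (u : U23) : (2 : ℤ) • u ∈ Jrad := by
  induction u using Submodule.Quotient.induction_on with
  | _ A =>
    have : (2 : ℤ) • (Submodule.Quotient.mk A : U23) = Submodule.Quotient.mk ((2 : ℤ) • A) := rfl
    rw [this, mk_mem_Jrad]
    refine ⟨_, A.2.2.1, ?_⟩
    rw [zsmul_entry]
    norm_num

theorem exists_scale (a b : ℚ) (ha : a ∈ Zloc 2 Nat.prime_two) (hb : b ∈ Zloc 2 Nat.prime_two)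
    (h : ¬ ((∃ z ∈ Zloc 2 Nat.prime_two, a = 2 * z) ∧ (∃ z ∈ Zloc 2 Nat.prime_two, b = 2 * z))) :
    ∃ l ∈ Zloc 2 Nat.prime_two, ∃ α β : ℤ, IsCoprime α β ∧ a * l = α ∧ b * l = β := by
  obtain ⟨n1, d1, hd1, h1⟩ := ha
  obtain ⟨n2, d2, hd2, h2⟩ := hb
  have hp : Prime ((2 : ℕ) : ℤ) := Nat.prime_iff_prime_int.mp Nat.prime_two
  have hdd : ¬ ((2 : ℕ) : ℤ) ∣ d1 * d2 := by
    intro h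
    rcases hp.dvd_mul.mp h with h | h
    exacts [hd1 h, hd2 h]
  have hg : ¬ ((2 : ℕ) : ℤ) ∣ (Int.gcd (n1 * d2) (n2 * d1) : ℤ) := by
    intro hg
    apply h
    constructor
    · obtain ⟨k, hk⟩ := hg.trans (Int.gcd_dvd_left _ _)
      refine ⟨a / 2, ⟨k, d1 * d2, hdd, ?_⟩, by ring⟩
      have hk' : (n1 : ℚ) * d2 = 2 * k := by exact_mod_cast hk
      push_cast
      linear_combination (1/2 : ℚ) * hk' + (d2 / 2 : ℚ) * h1
    · obtain ⟨k, hk⟩ := hg.trans (Int.gcd_dvd_right _ _)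
      refine ⟨b / 2, ⟨k, d1 * d2, hdd, ?_⟩, by ring⟩
      have hk' : (n2 : ℚ) * d1 = 2 * k := by exact_mod_cast hk
      push_cast
      linear_combination (1/2 : ℚ) * hk' + (d1 / 2 : ℚ) * h2
  have hg0 : 0 < Int.gcd (n1 * d2) (n2 * d1) := by
    rcases Nat.eq_zero_or_pos (Int.gcd (n1 * d2) (n2 * d1)) with h0 | h0
    · rw [h0] at hg
      exact absurd (by simp) hg
    · exact h0
  obtain ⟨α, hα⟩ := Int.gcd_dvd_left (n1 * d2) (n2 * d1)
  obtain ⟨β, hβ⟩ := Int.gcd_dvd_right (n1 * d2) (n2 * d1)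
  have hbez := Int.gcd_eq_gcd_ab (n1 * d2) (n2 * d1)
  set g := Int.gcd (n1 * d2) (n2 * d1) with hgdef
  have hgq : (g : ℚ) ≠ 0 := by exact_mod_cast hg0.ne'
  have hgz : (g : ℤ) ≠ 0 := by exact_mod_cast hg0.ne'
  have hα' : (n1 : ℚ) * d2 = g * α := by exact_mod_cast hα
  have hβ' : (n2 : ℚ) * d1 = g * β := by exact_mod_cast hβ
  refine ⟨(d1 * d2 : ℚ) / g, ⟨d1 * d2, g, hg, ?_⟩, α, β, ?_, ?_, ?_⟩
  · push_cast
    field_simp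
  · refine ⟨Int.gcdA (n1 * d2) (n2 * d1), Int.gcdB (n1 * d2) (n2 * d1), ?_⟩
    apply mul_left_cancel₀ hgz
    generalize Int.gcdA (n1 * d2) (n2 * d1) = x at *
    generalize Int.gcdB (n1 * d2) (n2 * d1) = y at *
    linear_combination (-1 : ℤ) * hbez - x * hα - y * hβ
  · field_simp
    linear_combination (d2 : ℚ) * h1 + hα'
  · field_simp
    linear_combination (d1 : ℚ) * h2 + hβ'

theorem key (u v : U23) (h : ¬ (u ∈ Jrad ∧ v ∈ Jrad)) :
    ∃ α β : ℤ, IsCoprime α β ∧ ∀ w : U23, ∃ r : R23ᵐᵒᵖ, r • u = α • w ∧ r • v = β • w := by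
  induction u using Submodule.Quotient.induction_on with
  | _ A =>
  induction v using Submodule.Quotient.induction_on with
  | _ B =>
  rw [mk_mem_Jrad, mk_mem_Jrad] at h
  obtain ⟨l, hl, α, β, hc, h1, h2⟩ := exists_scale _ _ A.2.2.1 B.2.2.1 h
  refine ⟨α, β, hc, fun w => ?_⟩
  induction w using Submodule.Quotient.induction_on with
  | _ C =>
  have main : ∀ (D : R23) (γ : ℤ), (D : Matrix (Fin 2) (Fin 2) ℚ) 0 0 * l = γ →
      (MulOpposite.op (rowElt (l * (C : Matrix (Fin 2) (Fin 2) ℚ) 0 0)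
        (l * (C : Matrix (Fin 2) (Fin 2) ℚ) 0 1)
        ((Zloc 2 Nat.prime_two).mul_mem hl C.2.2.1))) • (Submodule.Quotient.mk D : U23)
        = γ • (Submodule.Quotient.mk C : U23) := by
    intro D γ hD
    have e1 : γ • (Submodule.Quotient.mk C : U23) = Submodule.Quotient.mk (γ • C) := rfl
    rw [e1, ← Submodule.Quotient.mk_smul, Submodule.Quotient.eq]
    refine ⟨?_, ?_, ?_⟩
    · simp [-zsmul_eq_mul, zsmul_entry, rowElt, Matrix.mul_apply, Fin.sum_univ_two]
      linear_combination ((C : Matrix (Fin 2) (Fin 2) ℚ) 0 0) * hD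
    · convert (Zloc 3 Nat.prime_three).zero_mem using 1
      simp [-zsmul_eq_mul, zsmul_entry, rowElt, Matrix.mul_apply, Fin.sum_univ_two]
      linear_combination ((C : Matrix (Fin 2) (Fin 2) ℚ) 0 1) * hD
    · exact Subtype.property (_ : R23) |>.2.2
  exact ⟨_, main A α h1, main B β h2⟩

theorem proper_le (N : Submodule R23ᵐᵒᵖ U23) (h : N ≠ ⊤) : N ≤ Jrad := by
  intro u hu
  by_contra hJ
  apply h
  rw [eq_top_iff]
  intro w _
  obtain ⟨α, β, ⟨x, y, hxy⟩, hr⟩ := key u u (fun h => hJ h.1)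
  obtain ⟨r, h1, h2⟩ := hr w
  have : w = x • (r • u) + y • (r • u) := by
    rw [h1]
    nth_rewrite 2 [← h1]
    rw [h2, smul_smul, smul_smul, ← add_smul, hxy, one_smul]
  rw [this]
  have hN := N.smul_mem r hu
  exact N.add_mem (zsmul_mem hN x) (zsmul_mem hN y)

theorem zsmul_J (n : ℤ) {u : U23} (h : u ∈ Jrad) : n • u ∈ Jrad := zsmul_mem h n

/-- The map `(u, v) ↦ γ u + δ v`. -/
def combo (γ δ : ℤ) : (U23 × U23) →ₗ[R23ᵐᵒᵖ] U23 where
  toFun x := γ • x.1 + δ • x.2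
  map_add' x y := by simp only [Prod.fst_add, Prod.snd_add, smul_add]; abel
  map_smul' r x := by
    simp only [Prod.smul_fst, Prod.smul_snd, RingHom.id_apply, smul_add]
    rw [smul_comm γ r, smul_comm δ r]

/-- The map `w ↦ (α w, β w)`. -/
def diag (α β : ℤ) : U23 →ₗ[R23ᵐᵒᵖ] (U23 × U23) where
  toFun w := (α • w, β • w)
  map_add' x y := by simp
  map_smul' r x := by
    simp only [RingHom.id_apply, Prod.smul_mk]
    rw [smul_comm α r, smul_comm β r]

theorem isCompl_diag (α β x y : ℤ) (h : x * α + y * β = 1) :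
    IsCompl (LinearMap.range (diag α β)) (LinearMap.range (diag (-y) x)) := by
  constructor
  · rw [Submodule.disjoint_def]
    rintro _ ⟨w, rfl⟩ ⟨w', h'⟩
    have h1 : (-y) • w' = α • w := congrArg Prod.fst h'
    have h2 : x • w' = β • w := congrArg Prod.snd h'
    have : w = 0 := by
      calc w = (x * α + y * β) • w := by rw [h, one_smul]
        _ = x • (α • w) + y • (β • w) := by rw [add_smul, mul_smul, mul_smul]
        _ = x • ((-y) • w') + y • (x • w') := by rw [h1, h2]
        _ = (x * (-y) + y * x) • w' := by rw [add_smul, mul_smul, mul_smul]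
        _ = 0 := by rw [show x * (-y) + y * x = 0 by ring, zero_smul]
    simp [this]
  · rw [codisjoint_iff, eq_top_iff]
    rintro ⟨u, v⟩ _
    rw [Submodule.mem_sup]
    refine ⟨_, ⟨x • u + y • v, rfl⟩, _, ⟨(-β) • u + α • v, rfl⟩, ?_⟩
    simp only [diag, LinearMap.coe_mk, AddHom.coe_mk, Prod.mk_add_mk, Prod.mk.injEq]
    constructor
    · calc _ = (x * α + y * β) • u := by module
        _ = u := by rw [h, one_smul]
    · calc _ = (x * α + y * β) • v := by module
        _ = v := by rw [h, one_smul]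

theorem ker_combo (α β x y : ℤ) (h : x * α + y * β = 1) :
    LinearMap.ker (combo (-β) α) ≤ LinearMap.range (diag α β) := by
  rintro ⟨u, v⟩ huv
  have huv : (-β) • u + α • v = 0 := huv
  refine ⟨x • u + y • v, ?_⟩
  simp only [diag, LinearMap.coe_mk, AddHom.coe_mk, Prod.mk.injEq]
  constructor
  · calc _ = (x * α + y * β) • u + y • ((-β) • u + α • v) := by module
      _ = u := by rw [h, huv, one_smul, smul_zero, add_zero]
  · calc _ = (x * α + y * β) • v - x • ((-β) • u + α • v) := by module
      _ = v := by rw [h, huv, one_smul, smul_zero, sub_zero]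

theorem combo_surj (α β x y : ℤ) (h : x * α + y * β = 1) (u : U23) :
    ∃ m, combo (-β) α m = u := by
  refine ⟨((-y) • u, x • u), ?_⟩
  calc (-β) • ((-y) • u) + α • (x • u) = (x * α + y * β) • u := by module
    _ = u := by rw [h, one_smul]

/-- A submodule not inside `J × J` contains a nice summand. -/
theorem exists_summand (N : Submodule R23ᵐᵒᵖ (U23 × U23)) (h : ¬ N ≤ Jrad.prod Jrad) :
    ∃ α β x y : ℤ, x * α + y * β = 1 ∧ LinearMap.range (diag α β) ≤ N := by
  obtain ⟨⟨u, v⟩, hN, hJ⟩ := SetLike.not_le_iff_exists.1 h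
  obtain ⟨α, β, ⟨x, y, hxy⟩, hr⟩ := key u v hJ
  refine ⟨α, β, x, y, hxy, ?_⟩
  rintro _ ⟨w, rfl⟩
  obtain ⟨r, h1, h2⟩ := hr w
  have : diag α β w = r • (u, v) := by
    rw [Prod.smul_mk, h1, h2]
    rfl
  rw [this]
  exact N.smul_mem r hN

theorem le_comap_of_ne_top (α β x y : ℤ) (h : x * α + y * β = 1)
    (N : Submodule R23ᵐᵒᵖ (U23 × U23)) (hN : LinearMap.range (diag α β) ≤ N) (hne : N ≠ ⊤) :
    N ≤ Jrad.comap (combo (-β) α) := by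
  rw [← Submodule.map_le_iff_le_comap]
  apply proper_le
  intro htop
  apply hne
  rw [eq_top_iff]
  intro m _
  have : combo (-β) α m ∈ N.map (combo (-β) α) := by rw [htop]; trivial
  obtain ⟨n, hn, hnm⟩ := this
  have hk : m - n ∈ N := hN (ker_combo α β x y h (by
    rw [LinearMap.mem_ker, map_sub, hnm, sub_self]))
  have := N.add_mem hk hn
  simpa using this

theorem comap_ne_top (α β x y : ℤ) (h : x * α + y * β = 1) :
    Jrad.comap (combo (-β) α) ≠ ⊤ := by
  intro ht
  obtain ⟨m, hm⟩ := combo_surj α β x y h (Submodule.Quotient.mk 1)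
  apply one_not_mem
  rw [← hm]
  have : m ∈ Jrad.comap (combo (-β) α) := by rw [ht]; trivial
  exact this

theorem small_map {R M : Type*} [Ring R] [AddCommGroup M] [Module R M] (X N : Submodule R M)
    (hX : X ≤ N) (h : ∀ K : Submodule R M, X ≤ K → N ⊔ K = ⊤ → K = ⊤) :
    IsSmallSubmodule (N.map X.mkQ) := by
  intro K hK htop
  apply hK
  have h1 : K.comap X.mkQ = ⊤ := by
    apply h
    · intro x hx
      have : X.mkQ x = 0 := by simpa using hx
      rw [Submodule.mem_comap, this]
      exact K.zero_mem
    · rw [eq_top_iff]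
      intro m _
      have hm : X.mkQ m ∈ N.map X.mkQ ⊔ K := by rw [htop]; trivial
      obtain ⟨_, ⟨n, hn, rfl⟩, k, hk, e⟩ := Submodule.mem_sup.1 hm
      refine Submodule.mem_sup.2 ⟨n, hn, m - n, ?_, by abel⟩
      rw [Submodule.mem_comap, map_sub, ← e]
      simpa using hk
  rw [eq_top_iff]
  intro k _
  obtain ⟨m, rfl⟩ := X.mkQ_surjective k
  have : m ∈ K.comap X.mkQ := by rw [h1]; trivial
  exact this

theorem lifting_U23 : IsLiftingModule R23ᵐᵒᵖ (U23 × U23) := by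
  intro N
  by_cases hN : N = ⊤
  · subst hN
    refine ⟨⊤, le_rfl, ⟨⊥, isCompl_top_bot⟩, small_map _ _ le_rfl ?_⟩
    intro K hK _
    exact top_le_iff.1 hK
  by_cases hJ : N ≤ Jrad.prod Jrad
  · refine ⟨⊥, bot_le, ⟨⊤, isCompl_bot_top⟩, small_map _ _ bot_le ?_⟩
    intro K _ hK
    by_contra hKt
    by_cases hKJ : K ≤ Jrad.prod Jrad
    · have h1 : (⊤ : Submodule R23ᵐᵒᵖ (U23 × U23)) ≤ Jrad.prod Jrad := hK ▸ sup_le hJ hKJ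
      exact one_not_mem (h1 (x := (Submodule.Quotient.mk 1, 0)) trivial).1
    · obtain ⟨α, β, x, y, h, hX⟩ := exists_summand K hKJ
      apply comap_ne_top α β x y h
      rw [eq_top_iff, ← hK]
      refine sup_le (fun m hm => ?_) (le_comap_of_ne_top α β x y h K hX hKt)
      exact Jrad.add_mem (zsmul_J _ (hJ hm).1) (zsmul_J _ (hJ hm).2)
  · obtain ⟨α, β, x, y, h, hX⟩ := exists_summand N hJ
    refine ⟨_, hX, ⟨_, isCompl_diag α β x y h⟩, small_map _ _ hX ?_⟩
    intro K hXK hK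
    by_contra hKt
    apply comap_ne_top α β x y h
    rw [eq_top_iff, ← hK]
    exact sup_le (le_comap_of_ne_top α β x y h N hX hN) (le_comap_of_ne_top α β x y h K hXK hKt)

/-- A nonzero element of `U` killed by `3`. -/
def tElt : U23 := Submodule.Quotient.mk (rowElt 0 (1 / 3) (Zloc 2 Nat.prime_two).zero_mem)

theorem tElt_ne : tElt ≠ 0 := by
  intro h
  have h1 := (Submodule.Quotient.mk_eq_zero _).1 h
  obtain ⟨n, d, hd, hz⟩ := h1.2.1
  simp [rowElt] at hz
  apply hd
  refine ⟨n, ?_⟩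
  have : (d : ℚ) = 3 * n := by linarith
  exact_mod_cast this

theorem three_tElt : (3 : ℤ) • tElt = 0 := by
  have : (3 : ℤ) • tElt = Submodule.Quotient.mk
    ((3 : ℤ) • (rowElt 0 (1 / 3) (Zloc 2 Nat.prime_two).zero_mem)) := rfl
  rw [this]
  refine (Submodule.Quotient.mk_eq_zero _).2 ⟨?_, ?_, ?_⟩
  · rw [zsmul_entry]
    simp [rowElt]
  · convert (Zloc 3 Nat.prime_three).one_mem using 1
    rw [zsmul_entry]
    simp [rowElt]
  · exact Subtype.property (_ : R23) |>.2.2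

theorem not_FIEP_U23 : ¬ SatisfiesFIEP R23ᵐᵒᵖ (U23 × U23) := by
  intro H
  have hc : (1 : ℤ) * (-2) + 1 * 3 = 1 := by norm_num
  obtain ⟨Mi', hle, hsup, hdis⟩ := H (LinearMap.range (diag (-2) 3)) ⟨_, isCompl_diag _ _ _ _ hc⟩ 2
    ![LinearMap.ker (LinearMap.snd R23ᵐᵒᵖ U23 U23), LinearMap.ker (LinearMap.fst R23ᵐᵒᵖ U23 U23)]
    (by
      constructor
      · rw [eq_top_iff]
        rintro ⟨u, v⟩ _
        have h0 : ((u, 0) : U23 × U23) ∈ ⨆ i, (![LinearMap.ker (LinearMap.snd R23ᵐᵒᵖ U23 U23),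
            LinearMap.ker (LinearMap.fst R23ᵐᵒᵖ U23 U23)] : Fin 2 → _) i :=
          Submodule.mem_iSup_of_mem 0 (by simp)
        have h1 : ((0, v) : U23 × U23) ∈ ⨆ i, (![LinearMap.ker (LinearMap.snd R23ᵐᵒᵖ U23 U23),
            LinearMap.ker (LinearMap.fst R23ᵐᵒᵖ U23 U23)] : Fin 2 → _) i :=
          Submodule.mem_iSup_of_mem 1 (by simp)
        simpa using Submodule.add_mem _ h0 h1
      · have hd : Disjoint (LinearMap.ker (LinearMap.snd R23ᵐᵒᵖ U23 U23))
            (LinearMap.ker (LinearMap.fst R23ᵐᵒᵖ U23 U23)) := by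
          rw [Submodule.disjoint_def]
          rintro ⟨u, v⟩ h1 h2
          exact Prod.ext h2 h1
        intro i
        fin_cases i
        · refine hd.mono_right (iSup₂_le fun j hj => ?_)
          fin_cases j
          · exact absurd rfl hj
          · exact le_rfl
        · refine hd.symm.mono_right (iSup₂_le fun j hj => ?_)
          fin_cases j
          · exact le_rfl
          · exact absurd rfl hj)
  have h0 : ∀ m ∈ Mi' 0, m.2 = 0 := fun m hm => hle 0 hm
  have h1 : ∀ m ∈ Mi' 1, m.1 = 0 := fun m hm => hle 1 hm
  have hP : (Mi' 0).map (LinearMap.fst R23ᵐᵒᵖ U23 U23) = ⊤ := by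
    by_contra hP
    have hPJ := Submodule.map_le_iff_le_comap.1 (proper_le _ hP)
    have htop : (⊤ : Submodule R23ᵐᵒᵖ (U23 × U23)) ≤
        Jrad.comap (LinearMap.fst R23ᵐᵒᵖ U23 U23) := by
      rw [← hsup]
      refine iSup_le fun o => ?_
      rcases o with _ | i
      · rintro _ ⟨w, rfl⟩
        have : (-2 : ℤ) • w ∈ Jrad := by
          rw [neg_smul]
          exact Jrad.neg_mem (two_smul_mem w)
        exact this
      · fin_cases i
        · exact hPJ
        · intro m hm
          have := h1 m hm
          rw [Submodule.mem_comap, LinearMap.fst_apply, this]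
          exact Jrad.zero_mem
    exact one_not_mem (htop (x := (Submodule.Quotient.mk 1, 0)) trivial)
  have ht : tElt ∈ (Mi' 0).map (LinearMap.fst R23ᵐᵒᵖ U23 U23) := by rw [hP]; trivial
  obtain ⟨⟨u, v⟩, hm, hu⟩ := ht
  have hu : u = tElt := hu
  have hv : v = 0 := h0 _ hm
  subst hu hv
  have hX : ((tElt, 0) : U23 × U23) ∈ LinearMap.range (diag (-2) 3) := by
    refine ⟨tElt, ?_⟩
    refine Prod.ext ?_ three_tElt
    change (-2 : ℤ) • tElt = tElt
    calc (-2 : ℤ) • tElt = tElt - (3 : ℤ) • tElt := by module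
      _ = tElt := by rw [three_tElt, sub_zero]
  have hd := Submodule.disjoint_def.1 (hdis none) (tElt, 0) hX
    (Submodule.mem_iSup_of_mem (some 0) (Submodule.mem_iSup_of_mem (by simp) hm))
  exact tElt_ne (congrArg Prod.fst hd)

end Ex23

/-- There exist a ring `R` and a right `R`-module `M` (formalized as a left module over
`Rᵐᵒᵖ`) such that `M` is lifting but `M` does not satisfy the finite internal exchange
property. (One may take `R = [[ℤ_(p), ℚ], [0, ℤ_(q)]]` for distinct primes `p`, `q` and
`M = (R/L)²` where `L = [[0, ℤ_(q)], [0, ℤ_(q)]]`.) -/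
theorem stmt_18 :
    ∃ (R : Type) (iR : Ring R) (M : Type) (iM : AddCommGroup M)
      (iMod : @Module Rᵐᵒᵖ M (@MulOpposite.instRing R iR).toSemiring iM.toAddCommMonoid),
      @IsLiftingModule Rᵐᵒᵖ M (@MulOpposite.instRing R iR) iM iMod ∧
        ¬ @SatisfiesFIEP Rᵐᵒᵖ M (@MulOpposite.instRing R iR) iM iMod := by
  exact ⟨Ex23.R23, inferInstance, Ex23.U23 × Ex23.U23, inferInstance, inferInstance, Ex23.lifting_U23,
    Ex23.not_FIEP_U23⟩
end

section
/- Let K be a field, let R be the subring of the 4×4 matrix ring over K consisting of matrices whose entries are arbitrary in the positions (1,1), (1,2), (1,3), (1,4), (2,2), (2,4), (3,3), (3,4), (4,4) and zero elsewhere, and let M = K⁴ be the right R-module of row vectors (with the matrix action of R). Then M has exactly six submodules, namely M, (0,K,K,K), (0,K,0,K), (0,0,K,K), (0,0,0,K) and 0; consequently M is hollow and uniform but not uniserial. -/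
open Matrix

/-- The subring of the `4 × 4` matrix ring over a field `K` consisting of the matrices
whose entries are arbitrary at the positions `(1,1), (1,2), (1,3), (1,4), (2,2), (2,4),
(3,3), (3,4), (4,4)` (in `1`-indexed notation) and zero elsewhere. -/
def FourRing (K : Type*) [Field K] : Subring (Matrix (Fin 4) (Fin 4) K) where
  carrier := {A | A 1 0 = 0 ∧ A 1 2 = 0 ∧ A 2 0 = 0 ∧ A 2 1 = 0 ∧
    A 3 0 = 0 ∧ A 3 1 = 0 ∧ A 3 2 = 0}
  zero_mem' := ⟨rfl, rfl, rfl, rfl, rfl, rfl, rfl⟩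
  one_mem' := by
    refine ⟨?_, ?_, ?_, ?_, ?_, ?_, ?_⟩ <;> simp [Matrix.one_apply]
  add_mem' := by
    rintro A B ⟨hA1, hA2, hA3, hA4, hA5, hA6, hA7⟩ ⟨hB1, hB2, hB3, hB4, hB5, hB6, hB7⟩
    refine ⟨?_, ?_, ?_, ?_, ?_, ?_, ?_⟩ <;> simp [*]
  neg_mem' := by
    rintro A ⟨hA1, hA2, hA3, hA4, hA5, hA6, hA7⟩
    refine ⟨?_, ?_, ?_, ?_, ?_, ?_, ?_⟩ <;> simp [*]
  mul_mem' := by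
    rintro A B ⟨hA1, hA2, hA3, hA4, hA5, hA6, hA7⟩ ⟨hB1, hB2, hB3, hB4, hB5, hB6, hB7⟩
    refine ⟨?_, ?_, ?_, ?_, ?_, ?_, ?_⟩ <;>
      simp [Matrix.mul_apply, Fin.sum_univ_four, *]

/-- The right action of `FourRing K` on row vectors `K⁴` by vector-matrix
multiplication, as a left action of the opposite ring. -/
instance (K : Type*) [Field K] : SMul (↥(FourRing K))ᵐᵒᵖ (Fin 4 → K) :=
  ⟨fun r v => v ᵥ* (r.unop : Matrix (Fin 4) (Fin 4) K)⟩

theorem FourRing.smul_def (K : Type*) [Field K] (r : (↥(FourRing K))ᵐᵒᵖ)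
    (v : Fin 4 → K) : r • v = v ᵥ* (r.unop : Matrix (Fin 4) (Fin 4) K) := rfl

/-- `K⁴` as a right `FourRing K`-module, i.e. a left module over the opposite ring. -/
instance (K : Type*) [Field K] : Module (↥(FourRing K))ᵐᵒᵖ (Fin 4 → K) where
  one_smul v := by
    rw [FourRing.smul_def]
    simp
  mul_smul r s v := by
    rw [FourRing.smul_def, FourRing.smul_def, FourRing.smul_def, MulOpposite.unop_mul]
    push_cast
    rw [Matrix.vecMul_vecMul]
  smul_zero r := by
    rw [FourRing.smul_def]
    exact Matrix.zero_vecMul _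
  smul_add r v w := by
    rw [FourRing.smul_def, FourRing.smul_def, FourRing.smul_def]
    exact Matrix.add_vecMul _ v w
  add_smul r s v := by
    rw [FourRing.smul_def, FourRing.smul_def, FourRing.smul_def, MulOpposite.unop_add]
    push_cast
    exact Matrix.vecMul_add _ _ v
  zero_smul v := by
    rw [FourRing.smul_def]
    simp


theorem FourRing.single_mem {K : Type*} [Field K]
    (N : Submodule (↥(FourRing K))ᵐᵒᵖ (Fin 4 → K)) {v : Fin 4 → K} (hv : v ∈ N)
    (i j : Fin 4) (hij : ∀ c : K, Matrix.single i j c ∈ FourRing K) (hi : v i ≠ 0) (c : K) :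
    (Pi.single j c : Fin 4 → K) ∈ N := by
  have h := N.smul_mem (MulOpposite.op ⟨Matrix.single i j ((v i)⁻¹ * c), hij _⟩) hv
  rw [FourRing.smul_def] at h
  convert h using 1
  ext k
  by_cases hk : k = j
  · subst hk
    simp [Matrix.vecMul, dotProduct, Matrix.single_apply, hi]
  · simp [Matrix.vecMul, dotProduct, Matrix.single_apply, hk, Ne.symm hk]

theorem FourRing.single_mem_ring {K : Type*} [Field K] (i j : Fin 4)
    (h : i = j ∨ i = 0 ∨ j = 3) (c : K) : Matrix.single i j c ∈ FourRing K := by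
  change _ ∧ _ ∧ _ ∧ _ ∧ _ ∧ _ ∧ _
  fin_cases i <;> fin_cases j <;> simp [Matrix.single_apply] at h ⊢

/-- Every submodule is determined by which coordinates are free. -/
theorem FourRing.classify {K : Type*} [Field K]
    (N : Submodule (↥(FourRing K))ᵐᵒᵖ (Fin 4 → K)) :
    ∃ p : Fin 4 → Prop, (p 0 → p 1) ∧ (p 0 → p 2) ∧ (p 1 → p 3) ∧ (p 2 → p 3) ∧
      ∀ v, v ∈ N ↔ ∀ j, v j ≠ 0 → p j := by
  have key : ∀ i j : Fin 4, (i = j ∨ i = 0 ∨ j = 3) →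
      (∀ c : K, (Pi.single i c : Fin 4 → K) ∈ N) →
      ∀ c : K, (Pi.single j c : Fin 4 → K) ∈ N := by
    intro i j h hi c
    exact FourRing.single_mem N (hi 1) i j (FourRing.single_mem_ring i j h) (by simp) c
  refine ⟨fun j => ∀ c : K, (Pi.single j c : Fin 4 → K) ∈ N, key 0 1 (by simp),
    key 0 2 (by simp), key 1 3 (by simp), key 2 3 (by simp), fun v => ⟨?_, ?_⟩⟩
  · intro hv j hj c
    exact FourRing.single_mem N hv j j (FourRing.single_mem_ring j j (by simp)) hj c
  · intro h
    rw [← Finset.univ_sum_single v]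
    refine N.sum_mem fun j _ => ?_
    by_cases hj : v j = 0
    · rw [hj, Pi.single_zero]; exact N.zero_mem
    · exact h j hj _

/-- The submodule with prescribed free coordinates. -/
def FourRing.sub (K : Type*) [Field K] (p : Fin 4 → Prop) (h01 : p 0 → p 1) (h02 : p 0 → p 2)
    (h13 : p 1 → p 3) (h23 : p 2 → p 3) : Submodule (↥(FourRing K))ᵐᵒᵖ (Fin 4 → K) where
  carrier := {v | ∀ j, ¬ p j → v j = 0}
  zero_mem' := fun _ _ => rfl
  add_mem' := by
    intro a b ha hb j hj
    simp [ha j hj, hb j hj]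
  smul_mem' := by
    intro r v hv
    obtain ⟨h1, h2, h3, h4, h5, h6, h7⟩ := r.unop.2
    have e0 := hv 0
    have e1 := hv 1
    have e2 := hv 2
    have e3 := hv 3
    intro j hj
    rw [FourRing.smul_def]
    fin_cases j
    · simp only [Fin.zero_eta] at hj
      simp [Matrix.vecMul, dotProduct, Fin.sum_univ_four, h1, h3, h5, e0 hj]
    · have hj : ¬ p 1 := hj
      simp [Matrix.vecMul, dotProduct, Fin.sum_univ_four, h4, h6, e1 hj, e0 (mt h01 hj)]
    · have hj : ¬ p 2 := hj
      simp [Matrix.vecMul, dotProduct, Fin.sum_univ_four, h2, h7, e2 hj, e0 (mt h02 hj)]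
    · have hj : ¬ p 3 := hj
      simp [Matrix.vecMul, dotProduct, Fin.sum_univ_four, e3 hj, e1 (mt h13 hj),
        e2 (mt h23 hj), e0 (mt h01 (mt h13 hj))]

theorem FourRing.mem_sub {K : Type*} [Field K] {p : Fin 4 → Prop} {h01 : p 0 → p 1}
    {h02 : p 0 → p 2} {h13 : p 1 → p 3} {h23 : p 2 → p 3} {v : Fin 4 → K} :
    v ∈ FourRing.sub K p h01 h02 h13 h23 ↔ ∀ j, ¬ p j → v j = 0 := Iff.rfl

theorem FourRing.range_eq (K : Type*) [Field K] :
    Set.range (fun N : Submodule (↥(FourRing K))ᵐᵒᵖ (Fin 4 → K) =>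
        (N : Set (Fin 4 → K))) =
      {Set.univ, {v | v 0 = 0}, {v | v 0 = 0 ∧ v 2 = 0}, {v | v 0 = 0 ∧ v 1 = 0},
        {v | v 0 = 0 ∧ v 1 = 0 ∧ v 2 = 0}, {0}} := by
  ext S
  simp only [Set.mem_range, Set.mem_insert_iff, Set.mem_singleton_iff]
  constructor
  · rintro ⟨N, rfl⟩
    obtain ⟨p, h01, h02, h13, h23, h⟩ := FourRing.classify N
    simp only [Set.ext_iff, SetLike.mem_coe, h, Set.mem_univ, Set.mem_setOf_eq,
      Set.mem_singleton_iff, funext_iff, Fin.forall_fin_succ (n := 3),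
      Fin.forall_fin_succ (n := 2), Fin.forall_fin_succ (n := 1), Fin.forall_fin_succ (n := 0),
      Fin.forall_fin_zero_pi, Fin.succ_zero_eq_one, Fin.succ_one_eq_two, IsEmpty.forall_iff,
      Pi.zero_apply]
    have e : (Fin.succ (2 : Fin 3)) = (3 : Fin 4) := rfl
    by_cases p0 : p 0 <;> by_cases p1 : p 1 <;> by_cases p2 : p 2 <;> by_cases p3 : p 3 <;>
      simp_all
  · rintro (rfl | rfl | rfl | rfl | rfl | rfl)
    · exact ⟨⊤, rfl⟩
    · refine ⟨FourRing.sub K (fun j => j ≠ 0) ?_ ?_ ?_ ?_, ?_⟩ <;> try simp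
      ext v; simp [FourRing.mem_sub]
    · refine ⟨FourRing.sub K (fun j => j ≠ 0 ∧ j ≠ 2) ?_ ?_ ?_ ?_, ?_⟩ <;> try simp
      ext v; simp [FourRing.mem_sub, Fin.forall_fin_succ]
    · refine ⟨FourRing.sub K (fun j => j ≠ 0 ∧ j ≠ 1) ?_ ?_ ?_ ?_, ?_⟩ <;> try simp
      ext v; simp [FourRing.mem_sub, Fin.forall_fin_succ]
    · refine ⟨FourRing.sub K (fun j => j = 3) ?_ ?_ ?_ ?_, ?_⟩ <;> try simp
      ext v; simp [FourRing.mem_sub, Fin.forall_fin_succ]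
    · exact ⟨⊥, rfl⟩

theorem FourRing.ncard_eq (K : Type*) [Field K] :
    ({Set.univ, {v | v 0 = 0}, {v | v 0 = 0 ∧ v 2 = 0}, {v | v 0 = 0 ∧ v 1 = 0},
        {v | v 0 = 0 ∧ v 1 = 0 ∧ v 2 = 0}, {0}} : Set (Set (Fin 4 → K))).ncard = 6 := by
  have aux : ∀ S T : Set (Fin 4 → K), S = T → ∀ j : Fin 4,
      ((Pi.single j 1 : Fin 4 → K) ∈ S ↔ (Pi.single j 1 : Fin 4 → K) ∈ T) := by
    rintro S T rfl j; rfl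
  rw [Set.ncard_insert_of_notMem, Set.ncard_insert_of_notMem, Set.ncard_insert_of_notMem,
    Set.ncard_insert_of_notMem, Set.ncard_insert_of_notMem, Set.ncard_singleton]
  all_goals
    simp only [Set.mem_insert_iff, Set.mem_singleton_iff, not_or]
    refine_lift ?_
    repeat' apply And.intro
  all_goals
    intro h
    have h0 := aux _ _ h 0
    have h1 := aux _ _ h 1
    have h2 := aux _ _ h 2
    have h3 := aux _ _ h 3
    simp at h0 h1 h2 h3

theorem FourRing.zero_of_ne_top {K : Type*} [Field K]
    (N : Submodule (↥(FourRing K))ᵐᵒᵖ (Fin 4 → K)) (hN : N ≠ ⊤) :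
    N ≤ FourRing.sub K (fun j => j ≠ 0) (by simp) (by simp) (by simp) (by simp) := by
  intro v hv j hj
  obtain rfl : j = 0 := not_not.1 hj
  by_contra h0
  apply hN
  obtain ⟨p, h01, h02, h13, h23, h⟩ := FourRing.classify N
  have p0 := (h v).1 hv 0 h0
  refine Submodule.eq_top_iff'.2 fun w => (h w).2 fun j _ => ?_
  fin_cases j
  exacts [p0, h01 p0, h02 p0, h13 (h01 p0)]

theorem FourRing.single_mem_of_ne_bot {K : Type*} [Field K]
    (N : Submodule (↥(FourRing K))ᵐᵒᵖ (Fin 4 → K)) (hN : N ≠ ⊥) :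
    (Pi.single 3 1 : Fin 4 → K) ∈ N := by
  obtain ⟨v, hv, hv0⟩ := N.exists_mem_ne_zero_of_ne_bot hN
  obtain ⟨i, hi⟩ := Function.ne_iff.1 hv0
  exact FourRing.single_mem N hv i 3 (FourRing.single_mem_ring i 3 (by simp)) hi 1

/-- The right `FourRing K`-module `M = K⁴` of row vectors has exactly six submodules,
namely `M`, `(0,K,K,K)`, `(0,K,0,K)`, `(0,0,K,K)`, `(0,0,0,K)` and `0`; consequently `M`
is hollow and uniform but not uniserial. -/
theorem stmt_19 (K : Type*) [Field K] :
    (Set.range (fun N : Submodule (↥(FourRing K))ᵐᵒᵖ (Fin 4 → K) =>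
        (N : Set (Fin 4 → K))) =
      {Set.univ, {v | v 0 = 0}, {v | v 0 = 0 ∧ v 2 = 0}, {v | v 0 = 0 ∧ v 1 = 0},
        {v | v 0 = 0 ∧ v 1 = 0 ∧ v 2 = 0}, {0}}) ∧
    (Set.range (fun N : Submodule (↥(FourRing K))ᵐᵒᵖ (Fin 4 → K) =>
        (N : Set (Fin 4 → K)))).ncard = 6 ∧
    IsHollowModule (↥(FourRing K))ᵐᵒᵖ (Fin 4 → K) ∧
    IsUniformModule (↥(FourRing K))ᵐᵒᵖ (Fin 4 → K) ∧
    ¬ IsUniserialModule (↥(FourRing K))ᵐᵒᵖ (Fin 4 → K) := by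
  refine ⟨FourRing.range_eq K, ?_, ⟨inferInstance, ?_⟩, ⟨inferInstance, ?_⟩, ?_⟩
  · rw [FourRing.range_eq]; exact FourRing.ncard_eq K
  · intro N hN X hX h
    have hle := sup_le (FourRing.zero_of_ne_top N hN) (FourRing.zero_of_ne_top X hX)
    rw [h] at hle
    have := hle (Submodule.mem_top (x := (Pi.single 0 1 : Fin 4 → K))) 0 (by simp)
    simp at this
  · intro N hN X hX h
    have hm : (Pi.single 3 1 : Fin 4 → K) ∈ N ⊓ X :=
      ⟨FourRing.single_mem_of_ne_bot N hN, FourRing.single_mem_of_ne_bot X hX⟩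
    rw [h, Submodule.mem_bot] at hm
    simp at hm
  · intro h
    rcases h (FourRing.sub K (fun j => j ≠ 0 ∧ j ≠ 2) (by simp) (by simp) (by simp) (by simp))
      (FourRing.sub K (fun j => j ≠ 0 ∧ j ≠ 1) (by simp) (by simp) (by simp) (by simp)) with h | h
    · have h1 := @h (Pi.single 1 1) (by simp [FourRing.mem_sub, Fin.forall_fin_succ]) 1 (by simp)
      simp at h1
    · have h1 := @h (Pi.single 2 1) (by simp [FourRing.mem_sub, Fin.forall_fin_succ]) 2 (by simp)
      simp at h1
end
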